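/- arXiv:2107.13460 — 3 statements merged into one kernel-verified Lean document; each statement's English description precedes it below -/
import Mathlib

section
/- Let γ₁, γ₂ be queenons, N ∈ ℕ, and ε > 0. If |γ₁(α) − γ₂(α)| < ε for every α ∈ I_N, then d(γ₁, γ₂) ≤ 8/N + 4N²ε. -/
open MeasureTheory Filter Topology
open scoped ENNReal

noncomputable section

/-- The square `[-1/2,1/2]²`. -/
def unitSq : Set (ℝ × ℝ) :=
  Set.Icc (-(1:ℝ)/2) (1/2) ×ˢ Set.Icc (-(1:ℝ)/2) (1/2)

/-- The square `σ_{i,j}^N` (for `i, j ∈ [N]`). -/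
def gridSq (N i j : ℕ) : Set (ℝ × ℝ) :=
  Set.Icc (-(1:ℝ)/2 + ((i:ℝ) - 1)/N) (-(1:ℝ)/2 + (i:ℝ)/N) ×ˢ
    Set.Icc (-(1:ℝ)/2 + ((j:ℝ) - 1)/N) (-(1:ℝ)/2 + (j:ℝ)/N)

/-- The cell of the partition `I_N` with index `i, j ∈ [2N]`. -/
def INcell (N i j : ℕ) : Set (ℝ × ℝ) :=
  {p ∈ unitSq | (-1 + ((i:ℝ) - 1)/N ≤ p.1 + p.2 ∧ p.1 + p.2 ≤ -1 + (i:ℝ)/N) ∧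
    (-1 + ((j:ℝ) - 1)/N ≤ p.2 - p.1 ∧ p.2 - p.1 ≤ -1 + (j:ℝ)/N)}

/-- The interval of the partition `J_N` of `[-1,1]` with index `i ∈ [2N]`. -/
def JNcell (N i : ℕ) : Set ℝ :=
  Set.Icc (-1 + ((i:ℝ) - 1)/N) (-1 + (i:ℝ)/N)

/-- A member of the family `R` of subsets of the square. -/
def Rset (a₁ b₁ a₂ b₂ : ℝ) : Set (ℝ × ℝ) :=
  {p ∈ unitSq | (a₁ ≤ p.1 + p.2 ∧ p.1 + p.2 ≤ b₁) ∧ (a₂ ≤ p.2 - p.1 ∧ p.2 - p.1 ≤ b₂)}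

/-- The distance `d` between two Borel measures on the square: the supremum of
`|γ₁(α) − γ₂(α)|` over `α ∈ R`. -/
def qdist (μ ν : Measure (ℝ × ℝ)) : ℝ :=
  sSup {t : ℝ | ∃ a₁ b₁ a₂ b₂ : ℝ, a₁ ∈ Set.Icc (-1:ℝ) 1 ∧ b₁ ∈ Set.Icc (-1:ℝ) 1 ∧
    a₂ ∈ Set.Icc (-1:ℝ) 1 ∧ b₂ ∈ Set.Icc (-1:ℝ) 1 ∧
    t = |(μ (Rset a₁ b₁ a₂ b₂)).toReal - (ν (Rset a₁ b₁ a₂ b₂)).toReal|}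

/-- A permuton: a Borel probability measure on the square with uniform marginals. -/
def IsPermuton (μ : Measure (ℝ × ℝ)) : Prop :=
  IsProbabilityMeasure μ ∧ μ unitSqᶜ = 0 ∧
  ∀ a b : ℝ, -(1:ℝ)/2 ≤ a → a ≤ b → b ≤ 1/2 →
    μ (Set.Icc a b ×ˢ Set.Icc (-(1:ℝ)/2) (1/2)) = ENNReal.ofReal (b - a) ∧
    μ (Set.Icc (-(1:ℝ)/2) (1/2) ×ˢ Set.Icc a b) = ENNReal.ofReal (b - a)

/-- An `N`-step permuton: a permuton with constant density on each square `σ_{i,j}^N`. -/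
def IsStepPermutonN (N : ℕ) (μ : Measure (ℝ × ℝ)) : Prop :=
  IsPermuton μ ∧
  ∀ i ∈ Finset.Icc 1 N, ∀ j ∈ Finset.Icc 1 N, ∃ c : ℝ≥0∞,
    ∀ s : Set (ℝ × ℝ), s ⊆ gridSq N i j → MeasurableSet s → μ s = c * volume s

/-- A step permuton. -/
def IsStepPermuton (μ : Measure (ℝ × ℝ)) : Prop :=
  ∃ N : ℕ, 0 < N ∧ IsStepPermutonN N μ

/-- Sub-uniform diagonal marginals. -/
def SubUniformDiag (μ : Measure (ℝ × ℝ)) : Prop :=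
  ∀ a b : ℝ, -1 ≤ a → a ≤ b → b ≤ 1 →
    μ {p ∈ unitSq | a ≤ p.1 + p.2 ∧ p.1 + p.2 ≤ b} ≤ ENNReal.ofReal (b - a) ∧
    μ {p ∈ unitSq | a ≤ p.2 - p.1 ∧ p.2 - p.1 ≤ b} ≤ ENNReal.ofReal (b - a)

/-- The set `Γ` of queenons: the closure, in the topology of weak convergence of Borel
probability measures, of the set of step permutons with sub-uniform diagonal marginals. -/
def queenons : Set (ProbabilityMeasure (ℝ × ℝ)) :=
  closure {μ : ProbabilityMeasure (ℝ × ℝ) |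
    IsStepPermuton μ.toMeasure ∧ SubUniformDiag μ.toMeasure}

/-- The pushforward `γ⁺` of `γ` under `(x,y) ↦ x+y`. -/
def diagPlus (γ : Measure (ℝ × ℝ)) : Measure ℝ := γ.map fun p => p.1 + p.2

/-- The pushforward `γ⁻` of `γ` under `(x,y) ↦ y−x`. -/
def diagMinus (γ : Measure (ℝ × ℝ)) : Measure ℝ := γ.map fun p => p.2 - p.1

/-- The measure `γ̄⁺` on `[-1,1]`, with `γ̄⁺([a,b]) = (b−a) − γ⁺([a,b])`. -/
def barPlus (γ : Measure (ℝ × ℝ)) : Measure ℝ :=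
  volume.restrict (Set.Icc (-1:ℝ) 1) - diagPlus γ

/-- The measure `γ̄⁻` on `[-1,1]`, with `γ̄⁻([a,b]) = (b−a) − γ⁻([a,b])`. -/
def barMinus (γ : Measure (ℝ × ℝ)) : Measure ℝ :=
  volume.restrict (Set.Icc (-1:ℝ) 1) - diagMinus γ

/-- The uniform probability measure on `[-1,1]` (density `1/2`). -/
def unif11 : Measure ℝ := (2 : ℝ≥0∞)⁻¹ • volume.restrict (Set.Icc (-1:ℝ) 1)

open Classical in
/-- The Kullback–Leibler divergence of `μ` with respect to `ν`, as an extended real: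
`∫ log (dμ/dν) dμ` if `μ ≪ ν` and the integrand is integrable, and `+∞` otherwise. -/
def DKL {X : Type*} [MeasurableSpace X] (μ ν : Measure X) : EReal :=
  if μ ≪ ν ∧ Integrable (fun x => Real.log (μ.rnDeriv ν x).toReal) μ then
    ((∫ x, Real.log (μ.rnDeriv ν x).toReal ∂μ : ℝ) : EReal)
  else ⊤

/-- The Q-entropy `H_q(γ) = −D_KL(γ) − D_KL(γ̄⁺) − D_KL(γ̄⁻) + 2 log 2 − 3`. -/
def Hq (γ : Measure (ℝ × ℝ)) : EReal :=
  -DKL γ (volume.restrict unitSq) - DKL (barPlus γ) unif11 - DKL (barMinus γ) unif11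
    + ((2 * Real.log 2 - 3 : ℝ) : EReal)

/-- The discrete approximation `H_q^N` of the Q-entropy. -/
def HqN (N : ℕ) (γ : Measure (ℝ × ℝ)) : ℝ :=
  -(∑ i ∈ Finset.Icc 1 (2*N), ∑ j ∈ Finset.Icc 1 (2*N),
      (γ (INcell N i j)).toReal *
        Real.log ((γ (INcell N i j)).toReal / (volume (INcell N i j)).toReal))
  - (∑ i ∈ Finset.Icc 1 (2*N),
      (barPlus γ (JNcell N i)).toReal *
        Real.log ((2*N : ℝ) * (barPlus γ (JNcell N i)).toReal))
  - (∑ i ∈ Finset.Icc 1 (2*N),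
      (barMinus γ (JNcell N i)).toReal *
        Real.log ((2*N : ℝ) * (barMinus γ (JNcell N i)).toReal))
  + 2 * Real.log 2 - 3

/-- An `n`-queens configuration: a subset of `[n]² = {1,…,n}²` with exactly one element in
each row and column and at most one element in each plus- and minus-diagonal. -/
def IsQueensConfig (n : ℕ) (q : Finset (ℕ × ℕ)) : Prop :=
  (∀ p ∈ q, p.1 ∈ Finset.Icc 1 n ∧ p.2 ∈ Finset.Icc 1 n) ∧
  (∀ y ∈ Finset.Icc 1 n, ∃! x : ℕ, (x, y) ∈ q) ∧
  (∀ x ∈ Finset.Icc 1 n, ∃! y : ℕ, (x, y) ∈ q) ∧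
  (∀ p ∈ q, ∀ p' ∈ q, p.1 + p.2 = p'.1 + p'.2 → p = p') ∧
  (∀ p ∈ q, ∀ p' ∈ q, (p.2 : ℤ) - (p.1 : ℤ) = (p'.2 : ℤ) - (p'.1 : ℤ) → p = p')

/-- `Q(n)`, the number of `n`-queens configurations. -/
def numQueens (n : ℕ) : ℕ :=
  Set.ncard {q : Finset (ℕ × ℕ) | IsQueensConfig n q}

/-- The measure `γ_q` associated to an `n`-queens configuration `q`: density `n` on each
square `σ_{i,j}^n` with `(i,j) ∈ q`, and `0` elsewhere. -/
def gammaOf (n : ℕ) (q : Finset (ℕ × ℕ)) : Measure (ℝ × ℝ) :=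
  volume.withDensity ((⋃ ij ∈ q, gridSq n ij.1 ij.2).indicator fun _ => (n : ℝ≥0∞))

/-- The set `B_n(γ,ε)` of `n`-queens configurations `q` with `d(γ_q, γ) < ε`. -/
def Bset (n : ℕ) (γ : Measure (ℝ × ℝ)) (ε : ℝ) : Set (Finset (ℕ × ℕ)) :=
  {q | IsQueensConfig n q ∧ qdist (gammaOf n q) γ < ε}

/-- `|B_n(γ,ε)|`. -/
def Bcard (n : ℕ) (γ : Measure (ℝ × ℝ)) (ε : ℝ) : ℕ := (Bset n γ ε).ncard

/-- The exponential of an extended real, with `exp(−∞) = 0`. -/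
def expEReal (x : EReal) : ℝ := if x = ⊥ then 0 else Real.exp x.toReal

/-- The measure `μ`, on the square, has sub-uniform marginal along the function `f`. -/
def SubUniformAlong (μ : Measure (ℝ × ℝ)) (f : ℝ × ℝ → ℝ) : Prop :=
  ∀ a b : ℝ, μ {p ∈ unitSq | a ≤ f p ∧ f p ≤ b} ≤ ENNReal.ofReal (b - a)

lemma abs_add_le_one_of_mem_unitSq {p : ℝ × ℝ} (hp : p ∈ unitSq) : |p.1 + p.2| ≤ 1 := by
  obtain ⟨⟨h1, h2⟩, h3, h4⟩ := hp
  exact abs_le.2 ⟨by linarith, by linarith⟩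

lemma abs_sub_le_one_of_mem_unitSq {p : ℝ × ℝ} (hp : p ∈ unitSq) : |p.2 - p.1| ≤ 1 := by
  obtain ⟨⟨h1, h2⟩, h3, h4⟩ := hp
  exact abs_le.2 ⟨by linarith, by linarith⟩

/-- For a function with values in `[-1,1]` on the square, only intervals inside `[-1,1]` matter. -/
lemma SubUniformAlong.of_forall_mem_Icc {μ : Measure (ℝ × ℝ)} {f : ℝ × ℝ → ℝ}
    (hf : ∀ p ∈ unitSq, |f p| ≤ 1)
    (h : ∀ a b : ℝ, -1 ≤ a → a ≤ b → b ≤ 1 →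
      μ {p ∈ unitSq | a ≤ f p ∧ f p ≤ b} ≤ ENNReal.ofReal (b - a)) :
    SubUniformAlong μ f := by
  intro a b
  have hsub : {p ∈ unitSq | a ≤ f p ∧ f p ≤ b} ⊆
      {p ∈ unitSq | max a (-1) ≤ f p ∧ f p ≤ min b 1} := by
    rintro p ⟨hp, h1, h2⟩
    have h3 := abs_le.1 (hf p hp)
    exact ⟨hp, max_le h1 h3.1, le_min h2 h3.2⟩
  rcases le_or_gt (max a (-1)) (min b 1) with hab | hab
  · refine (measure_mono hsub).trans ((h _ _ (le_max_right _ _) hab (min_le_right _ _)).trans ?_)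
    exact ENNReal.ofReal_le_ofReal (sub_le_sub (min_le_left _ _) (le_max_left _ _))
  · have hempty : {p ∈ unitSq | a ≤ f p ∧ f p ≤ b} = ∅ :=
      Set.eq_empty_of_forall_notMem fun p hp =>
        absurd ((hsub hp).2.1.trans (hsub hp).2.2) (not_le.2 hab)
    simp [hempty]

/-- Sub-uniformity of marginals is preserved under weak limits. -/
lemma SubUniformAlong.of_mem_closure {S : Set (ProbabilityMeasure (ℝ × ℝ))} {f : ℝ × ℝ → ℝ}
    (hf : Continuous f)
    (hS : ∀ μ ∈ S, μ.toMeasure unitSqᶜ = 0 ∧ SubUniformAlong μ.toMeasure f)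
    {γ : ProbabilityMeasure (ℝ × ℝ)} (hγ : γ ∈ closure S) :
    SubUniformAlong γ.toMeasure f := by
  intro a b
  rcases lt_or_ge b a with hab | hab
  · have hempty : {p ∈ unitSq | a ≤ f p ∧ f p ≤ b} = ∅ :=
      Set.eq_empty_of_forall_notMem fun p hp => absurd (hp.2.1.trans hp.2.2) (not_le.2 hab)
    simp [hempty]
  refine ENNReal.le_of_forall_pos_le_add fun δ hδ _ => ?_
  have hδ' : (0 : ℝ) < δ := hδ
  obtain ⟨u, hSu, hu⟩ := mem_closure_iff_ultrafilter.1 hγ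
  have hopen : IsOpen (f ⁻¹' Set.Ioo (a - δ / 2) (b + δ / 2)) := isOpen_Ioo.preimage hf
  have hlim : Tendsto id (u : Filter (ProbabilityMeasure (ℝ × ℝ))) (𝓝 γ) := hu
  calc γ.toMeasure {p ∈ unitSq | a ≤ f p ∧ f p ≤ b}
      ≤ γ.toMeasure (f ⁻¹' Set.Ioo (a - δ / 2) (b + δ / 2)) :=
        measure_mono fun p hp => ⟨by linarith [hp.2.1], by linarith [hp.2.2]⟩
    _ ≤ _ := ProbabilityMeasure.le_liminf_measure_open_of_tendsto hlim hopen
    _ ≤ ENNReal.ofReal (b - a) + δ := by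
      refine liminf_le_of_frequently_le' (Eventually.frequently ?_)
      filter_upwards [hSu] with μ hμ
      obtain ⟨hsupp, hsub⟩ := hS μ hμ
      calc μ.toMeasure (f ⁻¹' Set.Ioo (a - δ / 2) (b + δ / 2))
          ≤ μ.toMeasure ({p ∈ unitSq | a - δ / 2 ≤ f p ∧ f p ≤ b + δ / 2} ∪ unitSqᶜ) := by
            refine measure_mono fun p hp => ?_
            by_cases hpU : p ∈ unitSq
            · exact Or.inl ⟨hpU, hp.1.le, hp.2.le⟩
            · exact Or.inr hpU
        _ ≤ ENNReal.ofReal (b + δ / 2 - (a - δ / 2)) + 0 :=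
            (measure_union_le _ _).trans (add_le_add (hsub _ _) hsupp.le)
        _ = ENNReal.ofReal (b - a) + δ := by
            rw [add_zero, show b + δ / 2 - (a - δ / 2) = (b - a) + (δ : ℝ) by ring,
              ENNReal.ofReal_add (by linarith) hδ'.le, ENNReal.ofReal_coe_nnreal]

lemma subUniformAlong_add_of_mem_queenons {γ : ProbabilityMeasure (ℝ × ℝ)} (hγ : γ ∈ queenons) :
    SubUniformAlong γ.toMeasure fun p => p.1 + p.2 := by
  refine SubUniformAlong.of_mem_closure (by fun_prop) (fun μ hμ => ?_) hγ
  obtain ⟨⟨_, _, hperm, _⟩, hdiag⟩ := hμ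
  exact ⟨hperm.2.1, .of_forall_mem_Icc (fun _ => abs_add_le_one_of_mem_unitSq)
    fun a b ha hab hb => (hdiag a b ha hab hb).1⟩

lemma subUniformAlong_sub_of_mem_queenons {γ : ProbabilityMeasure (ℝ × ℝ)} (hγ : γ ∈ queenons) :
    SubUniformAlong γ.toMeasure fun p => p.2 - p.1 := by
  refine SubUniformAlong.of_mem_closure (by fun_prop) (fun μ hμ => ?_) hγ
  obtain ⟨⟨_, _, hperm, _⟩, hdiag⟩ := hμ
  exact ⟨hperm.2.1, .of_forall_mem_Icc (fun _ => abs_sub_le_one_of_mem_unitSq)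
    fun a b ha hab hb => (hdiag a b ha hab hb).2⟩

lemma SubUniformAlong.measure_level_eq_zero {μ : Measure (ℝ × ℝ)} {f : ℝ × ℝ → ℝ}
    (h : SubUniformAlong μ f) (c : ℝ) : μ {p ∈ unitSq | c ≤ f p ∧ f p ≤ c} = 0 := by
  simpa using h c c

lemma measurableSet_INcell (N i j : ℕ) : MeasurableSet (INcell N i j) := by
  have hplus : Continuous fun p : ℝ × ℝ => p.1 + p.2 := by fun_prop
  have hminus : Continuous fun p : ℝ × ℝ => p.2 - p.1 := by fun_prop
  exact ((isClosed_Icc.prod isClosed_Icc).inter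
    ((isClosed_Icc.preimage hplus).inter (isClosed_Icc.preimage hminus))).measurableSet

lemma neg_one_add_div_le_of_lt {N i i' : ℕ} (hii : i < i') :
    -1 + (i : ℝ) / N ≤ -1 + ((i' : ℝ) - 1) / N := by
  have h1 : (i : ℝ) + 1 ≤ i' := by exact_mod_cast hii
  gcongr
  linarith

/-- Distinct cells of `I_N` overlap in a null set. -/
lemma aedisjoint_INcell {μ : Measure (ℝ × ℝ)} (hplus : SubUniformAlong μ fun p => p.1 + p.2)
    (hminus : SubUniformAlong μ fun p => p.2 - p.1) {N i j i' j' : ℕ} (hne : (i, j) ≠ (i', j')) :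
    AEDisjoint μ (INcell N i j) (INcell N i' j') := by
  have hne' : i ≠ i' ∨ j ≠ j' := by
    by_contra! hcon
    exact hne (Prod.ext hcon.1 hcon.2)
  rcases hne' with hi | hj
  · rcases hi.lt_or_gt with hlt | hlt
    · refine measure_mono_null ?_ (hplus.measure_level_eq_zero (-1 + (i : ℝ) / N))
      rintro p ⟨⟨hp, h1, -⟩, -, h2, -⟩
      exact ⟨hp, (neg_one_add_div_le_of_lt hlt).trans h2.1, h1.2⟩
    · refine measure_mono_null ?_ (hplus.measure_level_eq_zero (-1 + (i' : ℝ) / N))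
      rintro p ⟨⟨hp, h1, -⟩, -, h2, -⟩
      exact ⟨hp, (neg_one_add_div_le_of_lt hlt).trans h1.1, h2.2⟩
  · rcases hj.lt_or_gt with hlt | hlt
    · refine measure_mono_null ?_ (hminus.measure_level_eq_zero (-1 + (j : ℝ) / N))
      rintro p ⟨⟨hp, -, h1⟩, -, -, h2⟩
      exact ⟨hp, (neg_one_add_div_le_of_lt hlt).trans h2.1, h1.2⟩
    · refine measure_mono_null ?_ (hminus.measure_level_eq_zero (-1 + (j' : ℝ) / N))
      rintro p ⟨⟨hp, -, h1⟩, -, -, h2⟩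
      exact ⟨hp, (neg_one_add_div_le_of_lt hlt).trans h1.1, h2.2⟩

lemma exists_mem_JNcell {N : ℕ} (hN : 0 < N) {s : ℝ} (hs : |s| ≤ 1) :
    ∃ i ∈ Finset.Icc 1 (2 * N), s ∈ JNcell N i := by
  obtain ⟨h1, h2⟩ := abs_le.1 hs
  have hN' : (0 : ℝ) < N := by exact_mod_cast hN
  have hnn : 0 ≤ (s + 1) * N := mul_nonneg (by linarith) hN'.le
  have hceil : (s + 1) * N ≤ ⌈(s + 1) * N⌉₊ := Nat.le_ceil _
  have hceil' : (⌈(s + 1) * N⌉₊ : ℝ) < (s + 1) * N + 1 := Nat.ceil_lt_add_one hnn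
  rcases Nat.eq_zero_or_pos ⌈(s + 1) * N⌉₊ with h0 | hpos
  · refine ⟨1, Finset.mem_Icc.2 ⟨le_rfl, by omega⟩, by simpa using h1, ?_⟩
    rw [h0, Nat.cast_zero] at hceil
    have hs1 : s + 1 ≤ 0 := nonpos_of_mul_nonpos_left hceil hN'
    have : 0 ≤ ((1 : ℕ) : ℝ) / N := by positivity
    linarith
  · refine ⟨⌈(s + 1) * N⌉₊, Finset.mem_Icc.2 ⟨hpos, Nat.ceil_le.2 ?_⟩, ?_, ?_⟩
    · push_cast
      exact mul_le_mul_of_nonneg_right (by linarith) hN'.le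
    · have := (div_le_iff₀ hN').2 (show (⌈(s + 1) * N⌉₊ : ℝ) - 1 ≤ (s + 1) * N by linarith)
      linarith
    · have := (le_div_iff₀ hN').2 hceil
      linarith

open Classical in
/-- The cells of `I_N` contained in the set `α`. -/
def innerCells (N : ℕ) (α : Set (ℝ × ℝ)) : Finset (ℕ × ℕ) :=
  {ij ∈ Finset.Icc 1 (2 * N) ×ˢ Finset.Icc 1 (2 * N) | INcell N ij.1 ij.2 ⊆ α}

lemma mem_innerCells {N : ℕ} {α : Set (ℝ × ℝ)} {ij : ℕ × ℕ} :
    ij ∈ innerCells N α ↔ (ij.1 ∈ Finset.Icc 1 (2 * N) ∧ ij.2 ∈ Finset.Icc 1 (2 * N)) ∧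
      INcell N ij.1 ij.2 ⊆ α := by
  simp only [innerCells, Finset.mem_filter, Finset.mem_product]

lemma card_innerCells_le (N : ℕ) (α : Set (ℝ × ℝ)) : (innerCells N α).card ≤ 4 * N ^ 2 := by
  have hsub : innerCells N α ⊆ Finset.Icc 1 (2 * N) ×ˢ Finset.Icc 1 (2 * N) :=
    fun ij hij => Finset.mem_product.2 (mem_innerCells.1 hij).1
  refine (Finset.card_le_card hsub).trans (le_of_eq ?_)
  rw [Finset.card_product, Nat.card_Icc]
  simp only [Nat.add_sub_cancel]
  ring

/-- A member of `R` is covered by the cells of `I_N` inside it and four strips of width `1/N`. -/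
lemma Rset_subset_biUnion_innerCells_union {N : ℕ} (hN : 0 < N) (a₁ b₁ a₂ b₂ : ℝ) :
    Rset a₁ b₁ a₂ b₂ ⊆ (⋃ ij ∈ innerCells N (Rset a₁ b₁ a₂ b₂), INcell N ij.1 ij.2) ∪
      (({p ∈ unitSq | a₁ ≤ p.1 + p.2 ∧ p.1 + p.2 ≤ a₁ + 1 / N} ∪
        {p ∈ unitSq | b₁ - 1 / N ≤ p.1 + p.2 ∧ p.1 + p.2 ≤ b₁}) ∪
       ({p ∈ unitSq | a₂ ≤ p.2 - p.1 ∧ p.2 - p.1 ≤ a₂ + 1 / N} ∪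
        {p ∈ unitSq | b₂ - 1 / N ≤ p.2 - p.1 ∧ p.2 - p.1 ≤ b₂})) := by
  rintro p ⟨hp, ⟨ha₁, hb₁⟩, ha₂, hb₂⟩
  obtain ⟨i, hi, hi1, hi2⟩ := exists_mem_JNcell hN (abs_add_le_one_of_mem_unitSq hp)
  obtain ⟨j, hj, hj1, hj2⟩ := exists_mem_JNcell hN (abs_sub_le_one_of_mem_unitSq hp)
  by_cases hin : INcell N i j ⊆ Rset a₁ b₁ a₂ b₂
  · refine Or.inl (Set.mem_biUnion (x := (i, j)) ?_ ⟨hp, ⟨hi1, hi2⟩, hj1, hj2⟩)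
    exact Finset.mem_coe.2 (mem_innerCells.2 ⟨⟨hi, hj⟩, hin⟩)
  · right
    contrapose! hin
    simp only [Set.mem_union, Set.mem_ofPred_eq, not_or, not_and, not_le] at hin
    obtain ⟨⟨h1, h2⟩, h3, h4⟩ := hin
    have h1' := h1 hp ha₁
    have h2' : p.1 + p.2 < b₁ - 1 / N := not_le.1 fun hle => absurd hb₁ (h2 hp hle).not_ge
    have h3' := h3 hp ha₂
    have h4' : p.2 - p.1 < b₂ - 1 / N := not_le.1 fun hle => absurd hb₂ (h4 hp hle).not_ge
    rintro q ⟨hq, ⟨hq1, hq2⟩, hq3, hq4⟩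
    rw [sub_div] at hi1 hj1 hq1 hq3
    exact ⟨hq, ⟨by linarith, by linarith⟩, by linarith, by linarith⟩

/-- The cells of `I_N` inside a member of `R` carry all but `4/N` of its mass. -/
lemma sum_innerCells_le_and_le_add {μ : Measure (ℝ × ℝ)} [IsFiniteMeasure μ]
    (hplus : SubUniformAlong μ fun p => p.1 + p.2) (hminus : SubUniformAlong μ fun p => p.2 - p.1)
    {N : ℕ} (hN : 0 < N) (a₁ b₁ a₂ b₂ : ℝ) :
    ∑ ij ∈ innerCells N (Rset a₁ b₁ a₂ b₂), μ.real (INcell N ij.1 ij.2) ≤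
        μ.real (Rset a₁ b₁ a₂ b₂) ∧
      μ.real (Rset a₁ b₁ a₂ b₂) ≤
        ∑ ij ∈ innerCells N (Rset a₁ b₁ a₂ b₂), μ.real (INcell N ij.1 ij.2) + 4 / N := by
  have hsum : μ.real (⋃ ij ∈ innerCells N (Rset a₁ b₁ a₂ b₂), INcell N ij.1 ij.2) =
      ∑ ij ∈ innerCells N (Rset a₁ b₁ a₂ b₂), μ.real (INcell N ij.1 ij.2) := by
    rw [measureReal_def, measure_biUnion_finset₀
      (fun ij _ ij' _ hne => aedisjoint_INcell hplus hminus hne)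
      (fun ij _ => (measurableSet_INcell N ij.1 ij.2).nullMeasurableSet),
      ENNReal.toReal_sum fun _ _ => measure_ne_top _ _]
    rfl
  have hstrip : ∀ {f : ℝ × ℝ → ℝ}, SubUniformAlong μ f → ∀ a b : ℝ, b - a = 1 / N →
      μ.real {p ∈ unitSq | a ≤ f p ∧ f p ≤ b} ≤ 1 / N := fun {f} hf a b hab =>
    ENNReal.toReal_le_of_le_ofReal (by positivity) (hab ▸ hf a b)
  rw [← hsum]
  refine ⟨measureReal_mono (Set.iUnion₂_subset fun ij hij => (mem_innerCells.1 hij).2), ?_⟩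
  refine (measureReal_mono (Rset_subset_biUnion_innerCells_union hN a₁ b₁ a₂ b₂)).trans ?_
  refine (measureReal_union_le _ _).trans (add_le_add le_rfl ?_)
  refine (measureReal_union_le _ _).trans ((add_le_add (measureReal_union_le _ _)
    (measureReal_union_le _ _)).trans ?_)
  have h1 := hstrip hplus a₁ (a₁ + 1 / N) (by ring)
  have h2 := hstrip hplus (b₁ - 1 / N) b₁ (by ring)
  have h3 := hstrip hminus a₂ (a₂ + 1 / N) (by ring)
  have h4 := hstrip hminus (b₂ - 1 / N) b₂ (by ring)
  have h5 : (4 : ℝ) / N = 1 / N + 1 / N + (1 / N + 1 / N) := by ring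
  linarith

/-- **Claim (`I_N` approximation of the metric).**
If two queenons agree within `ε` on every cell of `I_N`, then `d(γ₁,γ₂) ≤ 8/N + 4N²ε`. -/
theorem IN_approximation_of_metric (γ₁ γ₂ : ProbabilityMeasure (ℝ × ℝ))
    (hγ₁ : γ₁ ∈ queenons) (hγ₂ : γ₂ ∈ queenons) (N : ℕ) (hN : 0 < N) (ε : ℝ) (hε : 0 < ε)
    (h : ∀ i ∈ Finset.Icc 1 (2*N), ∀ j ∈ Finset.Icc 1 (2*N),
      |(γ₁.toMeasure (INcell N i j)).toReal - (γ₂.toMeasure (INcell N i j)).toReal| < ε) :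
    qdist γ₁.toMeasure γ₂.toMeasure ≤ 8/(N:ℝ) + 4*(N:ℝ)^2*ε := by
  refine Real.sSup_le ?_ (by positivity)
  rintro t ⟨a₁, b₁, a₂, b₂, -, -, -, -, rfl⟩
  obtain ⟨hl₁, hu₁⟩ := sum_innerCells_le_and_le_add (subUniformAlong_add_of_mem_queenons hγ₁)
    (subUniformAlong_sub_of_mem_queenons hγ₁) hN a₁ b₁ a₂ b₂
  obtain ⟨hl₂, hu₂⟩ := sum_innerCells_le_and_le_add (subUniformAlong_add_of_mem_queenons hγ₂)
    (subUniformAlong_sub_of_mem_queenons hγ₂) hN a₁ b₁ a₂ b₂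
  set A := innerCells N (Rset a₁ b₁ a₂ b₂)
  have hdiff : |∑ ij ∈ A, γ₁.toMeasure.real (INcell N ij.1 ij.2) -
      ∑ ij ∈ A, γ₂.toMeasure.real (INcell N ij.1 ij.2)| ≤ 4 * (N : ℝ) ^ 2 * ε := by
    rw [← Finset.sum_sub_distrib]
    refine (Finset.abs_sum_le_sum_abs _ _).trans ((Finset.sum_le_card_nsmul _ _ ε ?_).trans ?_)
    · intro ij hij
      obtain ⟨hi, hj⟩ := (mem_innerCells.1 hij).1
      exact (h _ hi _ hj).le
    · rw [nsmul_eq_mul]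
      have hcard : (A.card : ℝ) ≤ 4 * (N : ℝ) ^ 2 := by
        exact_mod_cast card_innerCells_le N (Rset a₁ b₁ a₂ b₂)
      gcongr
  simp only [← measureReal_def]
  have h84 : (8 : ℝ) / N = 4 / N + 4 / N := by ring
  have h4 : (0 : ℝ) ≤ 4 / N := by positivity
  obtain ⟨hd₁, hd₂⟩ := abs_le.1 hdiff
  exact abs_le.2 ⟨by linarith, by linarith⟩

end
end

section
/- The function d is a metric on the space of Borel probability measures on [−1/2,1/2]²; the set Γ of queenons is convex; (Γ, d) is a compact metric space; and on Γ, convergence in d coincides with weak convergence of probability measures (a sequence of queenons converges to a queenon in d if and only if it converges weakly). -/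
open MeasureTheory Filter Topology
open scoped ENNReal

noncomputable section

section Metric

variable {μ ν ρ : Measure (ℝ × ℝ)}

lemma le_qdist [IsProbabilityMeasure μ] [IsProbabilityMeasure ν] {a₁ b₁ a₂ b₂ : ℝ}
    (ha₁ : a₁ ∈ Set.Icc (-1 : ℝ) 1) (hb₁ : b₁ ∈ Set.Icc (-1 : ℝ) 1)
    (ha₂ : a₂ ∈ Set.Icc (-1 : ℝ) 1) (hb₂ : b₂ ∈ Set.Icc (-1 : ℝ) 1) :
    |μ.real (Rset a₁ b₁ a₂ b₂) - ν.real (Rset a₁ b₁ a₂ b₂)| ≤ qdist μ ν := by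
  refine le_csSup ⟨1, ?_⟩ ⟨a₁, b₁, a₂, b₂, ha₁, hb₁, ha₂, hb₂, rfl⟩
  rintro t ⟨a, b, c, d, -, -, -, -, rfl⟩
  have h₁ : μ.real (Rset a b c d) ≤ 1 := measureReal_le_one
  have h₂ : ν.real (Rset a b c d) ≤ 1 := measureReal_le_one
  have h₃ : 0 ≤ μ.real (Rset a b c d) := measureReal_nonneg
  have h₄ : 0 ≤ ν.real (Rset a b c d) := measureReal_nonneg
  simp only [Measure.real] at h₁ h₂ h₃ h₄
  rw [abs_le]
  constructor <;> linarith

lemma qdist_le {c : ℝ}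
    (h : ∀ a₁ b₁ a₂ b₂ : ℝ, a₁ ∈ Set.Icc (-1 : ℝ) 1 → b₁ ∈ Set.Icc (-1 : ℝ) 1 →
      a₂ ∈ Set.Icc (-1 : ℝ) 1 → b₂ ∈ Set.Icc (-1 : ℝ) 1 →
      |μ.real (Rset a₁ b₁ a₂ b₂) - ν.real (Rset a₁ b₁ a₂ b₂)| ≤ c) :
    qdist μ ν ≤ c := by
  have h0 : (0 : ℝ) ∈ Set.Icc (-1 : ℝ) 1 := by norm_num
  refine csSup_le ⟨_, 0, 0, 0, 0, h0, h0, h0, h0, rfl⟩ ?_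
  rintro t ⟨a, b, c, d, ha, hb, hc, hd, rfl⟩
  exact h a b c d ha hb hc hd

lemma qdist_nonneg : 0 ≤ qdist μ ν := by
  refine Real.sSup_nonneg ?_
  rintro t ⟨a, b, c, d, -, -, -, -, rfl⟩
  exact abs_nonneg _

lemma qdist_self : qdist μ μ = 0 :=
  le_antisymm (qdist_le fun _ _ _ _ _ _ _ _ => by simp) qdist_nonneg

lemma qdist_comm : qdist μ ν = qdist ν μ := by
  simp only [qdist, abs_sub_comm]

lemma qdist_triangle [IsProbabilityMeasure μ] [IsProbabilityMeasure ν] [IsProbabilityMeasure ρ] :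
    qdist μ ρ ≤ qdist μ ν + qdist ν ρ :=
  qdist_le fun _ _ _ _ ha hb hc hd =>
    (abs_sub_le _ _ _).trans (add_le_add (le_qdist ha hb hc hd) (le_qdist ha hb hc hd))

end Metric

lemma isCompact_unitSq : IsCompact unitSq := isCompact_Icc.prod isCompact_Icc

/-- The closed rectangle with sides parallel to the diagonals of the plane and with parameters
`q = (a₁, b₁, a₂, b₂)`. -/
def diagRect (q : ℝ × ℝ × ℝ × ℝ) : Set (ℝ × ℝ) :=
  {p | (q.1 ≤ p.1 + p.2 ∧ p.1 + p.2 ≤ q.2.1) ∧ (q.2.2.1 ≤ p.2 - p.1 ∧ p.2 - p.1 ≤ q.2.2.2)}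

lemma measure_Rset {μ : Measure (ℝ × ℝ)} (hμ : μ unitSqᶜ = 0) (a₁ b₁ a₂ b₂ : ℝ) :
    μ (Rset a₁ b₁ a₂ b₂) = μ (diagRect (a₁, b₁, a₂, b₂)) := by
  have : Rset a₁ b₁ a₂ b₂ = diagRect (a₁, b₁, a₂, b₂) ∩ unitSq := by
    ext p
    simp only [Rset, diagRect, Set.mem_ofPred_eq, Set.mem_inter_iff]
    tauto
  rw [this]
  exact measure_inter_conull hμ

lemma mem_unitSq_bounds {p : ℝ × ℝ} (hp : p ∈ unitSq) :
    (-1 ≤ p.1 + p.2 ∧ p.1 + p.2 ≤ 1) ∧ (-1 ≤ p.2 - p.1 ∧ p.2 - p.1 ≤ 1) := by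
  simp only [unitSq, Set.mem_prod, Set.mem_Icc] at hp
  obtain ⟨⟨h₁, h₂⟩, h₃, h₄⟩ := hp
  refine ⟨⟨?_, ?_⟩, ?_, ?_⟩ <;> linarith

/-- Finite measures on the plane that agree on products of left-infinite closed intervals are
equal. -/
lemma measure_ext_of_Iic_prod_Iic {μ ν : Measure (ℝ × ℝ)} [IsFiniteMeasure μ] [IsFiniteMeasure ν]
    (h : ∀ a b : ℝ, μ (Set.Iic a ×ˢ Set.Iic b) = ν (Set.Iic a ×ˢ Set.Iic b)) : μ = ν := by
  have h₁ : ∀ a : ℝ, ∀ t : Set ℝ, MeasurableSet t →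
      μ (Set.Iic a ×ˢ t) = ν (Set.Iic a ×ˢ t) := by
    intro a t ht
    have key : (μ.restrict (Set.Iic a ×ˢ Set.univ)).map Prod.snd =
        (ν.restrict (Set.Iic a ×ˢ Set.univ)).map Prod.snd := by
      refine Measure.ext_of_Iic _ _ fun b => ?_
      rw [Measure.map_apply measurable_snd measurableSet_Iic,
        Measure.map_apply measurable_snd measurableSet_Iic,
        Measure.restrict_apply (measurable_snd measurableSet_Iic),
        Measure.restrict_apply (measurable_snd measurableSet_Iic)]
      convert h a b using 2 <;> ext p <;> simp [Prod.le_def, and_comm]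
    have := congrArg (fun m => m t) key
    simp only [Measure.map_apply measurable_snd ht,
      Measure.restrict_apply (measurable_snd ht)] at this
    convert this using 2 <;> ext p <;> simp [and_comm]
  refine Measure.ext_prod fun {s t} hs ht => ?_
  have key : (μ.restrict (Set.univ ×ˢ t)).map Prod.fst =
      (ν.restrict (Set.univ ×ˢ t)).map Prod.fst := by
    refine Measure.ext_of_Iic _ _ fun b => ?_
    rw [Measure.map_apply measurable_fst measurableSet_Iic,
      Measure.map_apply measurable_fst measurableSet_Iic,
      Measure.restrict_apply (measurable_fst measurableSet_Iic),
      Measure.restrict_apply (measurable_fst measurableSet_Iic)]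
    convert h₁ b t ht using 2 <;> ext p <;> simp
  have := congrArg (fun m => m s) key
  simp only [Measure.map_apply measurable_fst hs,
    Measure.restrict_apply (measurable_fst hs)] at this
  convert this using 2 <;> ext p <;> simp

lemma eq_of_qdist_eq_zero {μ ν : Measure (ℝ × ℝ)} [IsProbabilityMeasure μ]
    [IsProbabilityMeasure ν] (hμ : μ unitSqᶜ = 0) (hν : ν unitSqᶜ = 0) (h : qdist μ ν = 0) :
    μ = ν := by
  have hR : ∀ b₁ ∈ Set.Icc (-1 : ℝ) 1, ∀ b₂ ∈ Set.Icc (-1 : ℝ) 1,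
      μ (Rset (-1) b₁ (-1) b₂) = ν (Rset (-1) b₁ (-1) b₂) := by
    intro b₁ hb₁ b₂ hb₂
    have := le_qdist (μ := μ) (ν := ν) (a₁ := -1) (a₂ := -1) (by norm_num) hb₁ (by norm_num) hb₂
    rw [h] at this
    have := abs_nonpos_iff.1 this
    exact (measureReal_eq_measureReal_iff).1 (sub_eq_zero.1 this)
  let T : ℝ × ℝ → ℝ × ℝ := fun p => (p.1 + p.2, p.2 - p.1)
  let S : ℝ × ℝ → ℝ × ℝ := fun p => ((p.1 - p.2) / 2, (p.1 + p.2) / 2)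
  have hT : Measurable T := by fun_prop
  have hS : Measurable S := by fun_prop
  have hST : S ∘ T = id := by
    funext p
    ext <;> simp only [S, T, Function.comp_apply, id] <;> ring
  have key : μ.map T = ν.map T := by
    have := Measure.isFiniteMeasure_map μ T
    have := Measure.isFiniteMeasure_map ν T
    refine measure_ext_of_Iic_prod_Iic fun a b => ?_
    rw [Measure.map_apply hT (measurableSet_Iic.prod measurableSet_Iic),
      Measure.map_apply hT (measurableSet_Iic.prod measurableSet_Iic),
      ← measure_inter_conull hμ, ← measure_inter_conull hν]
    by_cases hab : -1 ≤ a ∧ -1 ≤ b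
    · have : T ⁻¹' (Set.Iic a ×ˢ Set.Iic b) ∩ unitSq = Rset (-1) (min a 1) (-1) (min b 1) := by
        ext p
        simp only [T, Rset, Set.mem_inter_iff, Set.mem_preimage, Set.mem_prod, Set.mem_Iic,
          Set.mem_ofPred_eq, le_min_iff]
        constructor
        · rintro ⟨⟨h₁, h₂⟩, hp⟩
          have := mem_unitSq_bounds hp
          tauto
        · tauto
      rw [this]
      refine hR _ ?_ _ ?_ <;> simp [hab]
    · have : T ⁻¹' (Set.Iic a ×ˢ Set.Iic b) ∩ unitSq = ∅ := by
        rw [Set.eq_empty_iff_forall_notMem]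
        rintro p ⟨⟨h₁, h₂⟩, hp⟩
        have := mem_unitSq_bounds hp
        simp only [T, Set.mem_Iic] at h₁ h₂
        exact hab ⟨by linarith, by linarith⟩
      rw [this, measure_empty, measure_empty]
  have := congrArg (Measure.map S) key
  rwa [Measure.map_map hS hT, Measure.map_map hS hT, hST, Measure.map_id, Measure.map_id] at this

/-- The measure is supported on the square and its diagonal marginals are bounded by the Lebesgue
measure on closed intervals. -/
structure IsDiagBounded (μ : Measure (ℝ × ℝ)) : Prop where
  compl_unitSq : μ unitSqᶜ = 0
  plus (a b : ℝ) : μ {p | a ≤ p.1 + p.2 ∧ p.1 + p.2 ≤ b} ≤ ENNReal.ofReal (b - a)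
  minus (a b : ℝ) : μ {p | a ≤ p.2 - p.1 ∧ p.2 - p.1 ≤ b} ≤ ENNReal.ofReal (b - a)

lemma SubUniformDiag.isDiagBounded {μ : Measure (ℝ × ℝ)} (h : SubUniformDiag μ)
    (hμ : μ unitSqᶜ = 0) : IsDiagBounded μ := by
  have aux : ∀ g : ℝ × ℝ → ℝ, (∀ p ∈ unitSq, -1 ≤ g p ∧ g p ≤ 1) →
      (∀ a b : ℝ, -1 ≤ a → a ≤ b → b ≤ 1 →
        μ {p ∈ unitSq | a ≤ g p ∧ g p ≤ b} ≤ ENNReal.ofReal (b - a)) →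
      ∀ a b : ℝ, μ {p | a ≤ g p ∧ g p ≤ b} ≤ ENNReal.ofReal (b - a) := by
    intro g hg hbd a b
    rw [← measure_inter_conull hμ]
    by_cases hab : max a (-1) ≤ min b 1
    · calc μ ({p | a ≤ g p ∧ g p ≤ b} ∩ unitSq)
          ≤ μ {p ∈ unitSq | max a (-1) ≤ g p ∧ g p ≤ min b 1} := by
            refine measure_mono ?_
            rintro p ⟨⟨h₁, h₂⟩, hp⟩
            exact ⟨hp, max_le h₁ (hg p hp).1, le_min h₂ (hg p hp).2⟩
        _ ≤ ENNReal.ofReal (min b 1 - max a (-1)) :=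
            hbd _ _ (le_max_right _ _) hab (min_le_right _ _)
        _ ≤ ENNReal.ofReal (b - a) :=
            ENNReal.ofReal_le_ofReal (sub_le_sub (min_le_left _ _) (le_max_left _ _))
    · have : {p | a ≤ g p ∧ g p ≤ b} ∩ unitSq = ∅ := by
        rw [Set.eq_empty_iff_forall_notMem]
        rintro p ⟨⟨h₁, h₂⟩, hp⟩
        exact hab ((max_le h₁ (hg p hp).1).trans (le_min h₂ (hg p hp).2))
      simp [this]
  exact ⟨hμ, aux (fun p => p.1 + p.2) (fun p hp => (mem_unitSq_bounds hp).1)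
      fun a b h₁ h₂ h₃ => (h a b h₁ h₂ h₃).1,
    aux (fun p => p.2 - p.1) (fun p hp => (mem_unitSq_bounds hp).2)
      fun a b h₁ h₂ h₃ => (h a b h₁ h₂ h₃).2⟩

/-- A uniform bound on the masses of an open set passes to weak limits. -/
lemma measure_le_of_tendsto_of_isOpen {f : ℕ → ProbabilityMeasure (ℝ × ℝ)}
    {γ : ProbabilityMeasure (ℝ × ℝ)} (hf : Tendsto f atTop (𝓝 γ)) {G : Set (ℝ × ℝ)}
    (hG : IsOpen G) {c : ℝ≥0∞} (h : ∀ n, (f n).toMeasure G ≤ c) : γ.toMeasure G ≤ c :=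
  (ProbabilityMeasure.le_liminf_measure_open_of_tendsto hf hG).trans
    (liminf_le_of_frequently_le' (Frequently.of_forall h))

lemma measure_strip_le_of_tendsto {f : ℕ → ProbabilityMeasure (ℝ × ℝ)}
    {γ : ProbabilityMeasure (ℝ × ℝ)} (hf : Tendsto f atTop (𝓝 γ)) {g : ℝ × ℝ → ℝ}
    (hg : Continuous g)
    (h : ∀ n, ∀ a b : ℝ, (f n).toMeasure {p | a ≤ g p ∧ g p ≤ b} ≤ ENNReal.ofReal (b - a))
    (a b : ℝ) : γ.toMeasure {p | a ≤ g p ∧ g p ≤ b} ≤ ENNReal.ofReal (b - a) := by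
  have hε : ∀ ε : ℝ, 0 < ε →
      γ.toMeasure {p | a ≤ g p ∧ g p ≤ b} ≤ ENNReal.ofReal ((b + ε) - (a - ε)) := by
    intro ε hε
    have hopen : IsOpen {p | a - ε < g p ∧ g p < b + ε} :=
      (isOpen_lt continuous_const hg).inter (isOpen_lt hg continuous_const)
    refine (measure_mono ?_).trans (measure_le_of_tendsto_of_isOpen hf hopen fun n => ?_)
    · rintro p ⟨h₁, h₂⟩
      exact ⟨by linarith, by linarith⟩
    · refine (measure_mono ?_).trans (h n _ _)
      rintro p ⟨h₁, h₂⟩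
      exact ⟨h₁.le, h₂.le⟩
  have hlim : Tendsto (fun ε : ℝ => ENNReal.ofReal ((b + ε) - (a - ε))) (𝓝[>] 0)
      (𝓝 (ENNReal.ofReal (b - a))) := by
    have : Continuous fun ε : ℝ => ENNReal.ofReal ((b + ε) - (a - ε)) :=
      ENNReal.continuous_ofReal.comp (by fun_prop)
    simpa using (this.tendsto 0).mono_left nhdsWithin_le_nhds
  exact ge_of_tendsto hlim (eventually_mem_nhdsWithin.mono hε)

lemma isDiagBounded_of_tendsto {f : ℕ → ProbabilityMeasure (ℝ × ℝ)}
    {γ : ProbabilityMeasure (ℝ × ℝ)} (hf : Tendsto f atTop (𝓝 γ))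
    (h : ∀ n, IsDiagBounded (f n).toMeasure) : IsDiagBounded γ.toMeasure where
  compl_unitSq := nonpos_iff_eq_zero.1 <|
    measure_le_of_tendsto_of_isOpen hf isCompact_unitSq.isClosed.isOpen_compl
      fun n => (h n).compl_unitSq.le
  plus := measure_strip_le_of_tendsto hf (by fun_prop) fun n => (h n).plus
  minus := measure_strip_le_of_tendsto hf (by fun_prop) fun n => (h n).minus

lemma isDiagBounded_of_mem_queenons {γ : ProbabilityMeasure (ℝ × ℝ)} (hγ : γ ∈ queenons) :
    IsDiagBounded γ.toMeasure := by
  obtain ⟨f, hfS, hf⟩ := mem_closure_iff_seq_limit.1 hγ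
  refine isDiagBounded_of_tendsto hf fun n => ?_
  obtain ⟨⟨N, -, hN⟩, hsub⟩ := hfS n
  exact hsub.isDiagBounded hN.1.2.1

section Rect

variable {μ : Measure (ℝ × ℝ)}

lemma measureReal_diagRect_sub_le [IsFiniteMeasure μ] (hμ : IsDiagBounded μ)
    (q r : ℝ × ℝ × ℝ × ℝ) : μ.real (diagRect q) - μ.real (diagRect r) ≤ 4 * dist q r := by
  obtain ⟨a₁, b₁, a₂, b₂⟩ := q
  obtain ⟨a₁', b₁', a₂', b₂'⟩ := r
  have hsub : diagRect (a₁, b₁, a₂, b₂) ⊆ diagRect (a₁', b₁', a₂', b₂') ∪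
      (({p | a₁ ≤ p.1 + p.2 ∧ p.1 + p.2 ≤ a₁'} ∪ {p | b₁' ≤ p.1 + p.2 ∧ p.1 + p.2 ≤ b₁}) ∪
      ({p | a₂ ≤ p.2 - p.1 ∧ p.2 - p.1 ≤ a₂'} ∪ {p | b₂' ≤ p.2 - p.1 ∧ p.2 - p.1 ≤ b₂})) := by
    rintro p ⟨⟨h₁, h₂⟩, h₃, h₄⟩
    simp only [diagRect, Set.mem_union, Set.mem_ofPred_eq] at *
    grind
  have hd : |a₁ - a₁'| ≤ dist (a₁, b₁, a₂, b₂) (a₁', b₁', a₂', b₂') ∧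
      |b₁ - b₁'| ≤ dist (a₁, b₁, a₂, b₂) (a₁', b₁', a₂', b₂') ∧
      |a₂ - a₂'| ≤ dist (a₁, b₁, a₂, b₂) (a₁', b₁', a₂', b₂') ∧
      |b₂ - b₂'| ≤ dist (a₁, b₁, a₂, b₂) (a₁', b₁', a₂', b₂') := by
    simp [Prod.dist_eq, Real.dist_eq]
  have hplus : ∀ a b d : ℝ, b - a ≤ d → 0 ≤ d →
      μ.real {p | a ≤ p.1 + p.2 ∧ p.1 + p.2 ≤ b} ≤ d := fun a b d hab hd =>
    ENNReal.toReal_le_of_le_ofReal hd ((hμ.plus a b).trans (ENNReal.ofReal_le_ofReal hab))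
  have hminus : ∀ a b d : ℝ, b - a ≤ d → 0 ≤ d →
      μ.real {p | a ≤ p.2 - p.1 ∧ p.2 - p.1 ≤ b} ≤ d := fun a b d hab hd =>
    ENNReal.toReal_le_of_le_ofReal hd ((hμ.minus a b).trans (ENNReal.ofReal_le_ofReal hab))
  set D := dist (a₁, b₁, a₂, b₂) (a₁', b₁', a₂', b₂')
  have hD : 0 ≤ D := dist_nonneg
  obtain ⟨h₁, h₂, h₃, h₄⟩ := hd
  rw [abs_le] at h₁ h₂ h₃ h₄
  have e₁ := hplus a₁ a₁' D (by linarith) hD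
  have e₂ := hplus b₁' b₁ D (by linarith) hD
  have e₃ := hminus a₂ a₂' D (by linarith) hD
  have e₄ := hminus b₂' b₂ D (by linarith) hD
  have := (measureReal_mono (μ := μ) hsub).trans <| (measureReal_union_le _ _).trans <|
    add_le_add le_rfl <| (measureReal_union_le _ _).trans <|
      add_le_add (measureReal_union_le _ _) (measureReal_union_le _ _)
  linarith

lemma abs_measureReal_diagRect_sub_le [IsFiniteMeasure μ] (hμ : IsDiagBounded μ)
    (q r : ℝ × ℝ × ℝ × ℝ) : |μ.real (diagRect q) - μ.real (diagRect r)| ≤ 4 * dist q r := by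
  rw [abs_le]
  have h₁ := measureReal_diagRect_sub_le hμ q r
  have h₂ := measureReal_diagRect_sub_le hμ r q
  rw [dist_comm] at h₂
  constructor <;> linarith

lemma measure_frontier_diagRect (hμ : IsDiagBounded μ) (q : ℝ × ℝ × ℝ × ℝ) :
    μ (frontier (diagRect q)) = 0 := by
  obtain ⟨a₁, b₁, a₂, b₂⟩ := q
  have hs : Continuous fun p : ℝ × ℝ => p.1 + p.2 := by fun_prop
  have hd : Continuous fun p : ℝ × ℝ => p.2 - p.1 := by fun_prop
  have hclosed : IsClosed (diagRect (a₁, b₁, a₂, b₂)) :=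
    ((isClosed_le continuous_const hs).inter (isClosed_le hs continuous_const)).inter
      ((isClosed_le continuous_const hd).inter (isClosed_le hd continuous_const))
  have hopen : IsOpen {p : ℝ × ℝ | (a₁ < p.1 + p.2 ∧ p.1 + p.2 < b₁) ∧
      (a₂ < p.2 - p.1 ∧ p.2 - p.1 < b₂)} :=
    ((isOpen_lt continuous_const hs).inter (isOpen_lt hs continuous_const)).inter
      ((isOpen_lt continuous_const hd).inter (isOpen_lt hd continuous_const))
  have hint := interior_maximal (s := diagRect (a₁, b₁, a₂, b₂))
    (fun p hp => ⟨⟨hp.1.1.le, hp.1.2.le⟩, hp.2.1.le, hp.2.2.le⟩) hopen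
  have hplus : ∀ a : ℝ, μ {p | a ≤ p.1 + p.2 ∧ p.1 + p.2 ≤ a} = 0 := fun a => by
    simpa using hμ.plus a a
  have hminus : ∀ a : ℝ, μ {p | a ≤ p.2 - p.1 ∧ p.2 - p.1 ≤ a} = 0 := fun a => by
    simpa using hμ.minus a a
  rw [hclosed.frontier_eq]
  refine measure_mono_null ?_ (measure_union_null
    (measure_union_null (hplus a₁) (hplus b₁)) (measure_union_null (hminus a₂) (hminus b₂)))
  rintro p ⟨⟨⟨h₁, h₂⟩, h₃, h₄⟩, hp⟩
  have hp' : ¬ ((a₁ < p.1 + p.2 ∧ p.1 + p.2 < b₁) ∧ (a₂ < p.2 - p.1 ∧ p.2 - p.1 < b₂)) :=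
    fun h => hp (hint h)
  simp only [Set.mem_union, Set.mem_ofPred_eq] at *
  grind

end Rect

/-- Weak convergence of measures with bounded diagonal marginals implies convergence in `d`. -/
lemma tendsto_qdist_of_tendsto {f : ℕ → ProbabilityMeasure (ℝ × ℝ)}
    {γ : ProbabilityMeasure (ℝ × ℝ)} (hf : Tendsto f atTop (𝓝 γ))
    (h : ∀ n, IsDiagBounded (f n).toMeasure) :
    Tendsto (fun n => qdist (f n).toMeasure γ.toMeasure) atTop (𝓝 0) := by
  have hγ := isDiagBounded_of_tendsto hf h
  have hpt : ∀ q, Tendsto (fun n => (f n).toMeasure.real (diagRect q)) atTop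
      (𝓝 (γ.toMeasure.real (diagRect q))) := fun q =>
    (ENNReal.tendsto_toReal (measure_ne_top _ _)).comp
      (ProbabilityMeasure.tendsto_measure_of_null_frontier_of_tendsto' hf
        (measure_frontier_diagRect hγ q))
  let C : Set (ℝ × ℝ × ℝ × ℝ) :=
    Set.Icc (-1) 1 ×ˢ Set.Icc (-1) 1 ×ˢ Set.Icc (-1) 1 ×ˢ Set.Icc (-1) 1
  have hC : IsCompact C :=
    isCompact_Icc.prod (isCompact_Icc.prod (isCompact_Icc.prod isCompact_Icc))
  have hunif : TendstoUniformlyOn (fun n q => (f n).toMeasure.real (diagRect q))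
      (fun q => γ.toMeasure.real (diagRect q)) atTop C := by
    rw [← tendstoLocallyUniformlyOn_iff_tendstoUniformlyOn_of_compact hC,
      Metric.tendstoLocallyUniformlyOn_iff]
    intro ε hε q _
    refine ⟨Metric.ball q (ε / 16), mem_nhdsWithin_of_mem_nhds
      (Metric.ball_mem_nhds _ (by positivity)), ?_⟩
    filter_upwards [Metric.tendsto_nhds.1 (hpt q) (ε / 4) (by positivity)] with n hn r hr
    have h₁ := abs_measureReal_diagRect_sub_le (h n) r q
    have h₂ := abs_measureReal_diagRect_sub_le hγ r q
    rw [Metric.mem_ball] at hr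
    rw [Real.dist_eq, abs_lt] at hn ⊢
    rw [abs_le] at h₁ h₂
    constructor <;> linarith
  rw [Metric.tendsto_atTop]
  intro ε hε
  obtain ⟨N, hN⟩ := eventually_atTop.1
    (Metric.tendstoUniformlyOn_iff.1 hunif (ε / 2) (by positivity))
  refine ⟨N, fun n hn => ?_⟩
  rw [Real.dist_eq, sub_zero, abs_of_nonneg qdist_nonneg]
  refine (qdist_le fun a b c d ha hb hc hd => ?_).trans_lt (half_lt_self hε)
  have := hN n hn (a, b, c, d) ⟨ha, hb, hc, hd⟩
  rw [dist_comm, Real.dist_eq] at this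
  simpa only [Measure.real, measure_Rset (h n).compl_unitSq, measure_Rset hγ.compl_unitSq]
    using this.le

lemma isCompact_queenons : IsCompact queenons := by
  have hK : IsCompact {μ : ProbabilityMeasure (ℝ × ℝ) | ∀ _ : ℕ, μ unitSqᶜ ≤ 0} :=
    isCompact_setOfPred_probabilityMeasure_mass_eq_compl_isCompact_le (K := fun _ => unitSq)
      (u := fun _ => 0) tendsto_const_nhds (fun _ => isCompact_unitSq) (Or.inl inferInstance)
  refine hK.of_isClosed_subset isClosed_closure fun μ hμ _ => ?_
  rw [← ENNReal.coe_le_coe]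
  simpa using (isDiagBounded_of_mem_queenons hμ).compl_unitSq

lemma exists_subseq_tendsto_queenons {f : ℕ → ProbabilityMeasure (ℝ × ℝ)}
    (hf : ∀ n, f n ∈ queenons) :
    ∃ γ ∈ queenons, ∃ φ : ℕ → ℕ, StrictMono φ ∧ Tendsto (f ∘ φ) atTop (𝓝 γ) :=
  isCompact_queenons.isSeqCompact hf

lemma tendsto_of_tendsto_qdist {f : ℕ → ProbabilityMeasure (ℝ × ℝ)}
    {γ : ProbabilityMeasure (ℝ × ℝ)} (hf : ∀ n, f n ∈ queenons) (hγ : γ ∈ queenons)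
    (h : Tendsto (fun n => qdist (f n).toMeasure γ.toMeasure) atTop (𝓝 0)) :
    Tendsto f atTop (𝓝 γ) := by
  refine tendsto_of_subseq_tendsto fun ns hns => ?_
  obtain ⟨γ', hγ', φ, hφ, hlim⟩ := exists_subseq_tendsto_queenons fun n => hf (ns n)
  refine ⟨φ, ?_⟩
  have h₁ := tendsto_qdist_of_tendsto hlim
    fun n => isDiagBounded_of_mem_queenons (hf (ns (φ n)))
  have h₂ := h.comp (hns.comp hφ.tendsto_atTop)
  have hle : qdist γ.toMeasure γ'.toMeasure ≤ 0 + 0 := by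
    refine ge_of_tendsto (h₂.add h₁) (Eventually.of_forall fun n => ?_)
    simp only [Function.comp_apply]
    rw [qdist_comm (μ := (f (ns (φ n))).toMeasure) (ν := γ.toMeasure)]
    exact qdist_triangle
  have heq : γ = γ' := ProbabilityMeasure.toMeasure_injective <|
    eq_of_qdist_eq_zero (isDiagBounded_of_mem_queenons hγ).compl_unitSq
      (isDiagBounded_of_mem_queenons hγ').compl_unitSq
      (le_antisymm (by simpa using hle) qdist_nonneg)
  rw [heq]
  exact hlim

section Convex

lemma gridSq_mul_subset {N M : ℕ} (hN : 0 < N) (hM : 0 < M) {k l : ℕ}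
    (hk : 1 ≤ k) (hl : 1 ≤ l) :
    gridSq (N * M) k l ⊆ gridSq N ((k - 1) / M + 1) ((l - 1) / M + 1) := by
  have hN' : (0 : ℝ) < N := by exact_mod_cast hN
  have hM' : (0 : ℝ) < M := by exact_mod_cast hM
  have aux : ∀ k : ℕ, 1 ≤ k →
      Set.Icc (-(1:ℝ)/2 + ((k:ℝ) - 1)/(N * M : ℕ)) (-(1:ℝ)/2 + (k:ℝ)/(N * M : ℕ)) ⊆
      Set.Icc (-(1:ℝ)/2 + ((((k - 1) / M + 1 : ℕ) : ℝ) - 1)/N)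
        (-(1:ℝ)/2 + (((k - 1) / M + 1 : ℕ) : ℝ)/N) := by
    intro k hk
    have h₁ : ((k - 1) / M : ℕ) * M + 1 ≤ k := by
      have := Nat.div_mul_le_self (k - 1) M
      omega
    have h₂ : k ≤ ((k - 1) / M + 1) * M := by
      have := Nat.lt_div_mul_add (a := k - 1) hM
      rw [add_mul]
      omega
    have h₁' : (((k - 1) / M : ℕ) : ℝ) * M + 1 ≤ k := by exact_mod_cast h₁
    have h₂' : (k : ℝ) ≤ ((((k - 1) / M : ℕ) : ℝ) + 1) * M := by exact_mod_cast h₂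
    refine Set.Icc_subset_Icc (add_le_add le_rfl ?_) (add_le_add le_rfl ?_)
    · push_cast
      rw [div_le_div_iff₀ hN' (by positivity)]
      nlinarith
    · push_cast
      rw [div_le_div_iff₀ (by positivity) hN']
      nlinarith
  exact Set.prod_mono (aux k hk) (aux l hl)

lemma IsStepPermutonN.mul {N M : ℕ} {μ : Measure (ℝ × ℝ)} (hN : 0 < N) (hM : 0 < M)
    (h : IsStepPermutonN N μ) : IsStepPermutonN (N * M) μ := by
  have aux : ∀ k ∈ Finset.Icc 1 (N * M), (k - 1) / M + 1 ∈ Finset.Icc 1 N := by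
    intro k hk
    rw [Finset.mem_Icc] at hk ⊢
    have : (k - 1) / M < N := Nat.div_lt_of_lt_mul (by rw [mul_comm]; omega)
    exact ⟨Nat.le_add_left _ _, this⟩
  refine ⟨h.1, fun k hk l hl => ?_⟩
  obtain ⟨c, hc⟩ := h.2 _ (aux k hk) _ (aux l hl)
  exact ⟨c, fun s hs => hc s (hs.trans
    (gridSq_mul_subset hN hM (Finset.mem_Icc.1 hk).1 (Finset.mem_Icc.1 hl).1))⟩

variable {u v : ℝ≥0∞} {μ ν : Measure (ℝ × ℝ)}

lemma isProbabilityMeasure_mix [IsProbabilityMeasure μ] [IsProbabilityMeasure ν]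
    (huv : u + v = 1) : IsProbabilityMeasure (u • μ + v • ν) :=
  ⟨by simp [huv]⟩

lemma IsPermuton.mix (huv : u + v = 1) (hμ : IsPermuton μ) (hν : IsPermuton ν) :
    IsPermuton (u • μ + v • ν) := by
  have := hμ.1
  have := hν.1
  refine ⟨isProbabilityMeasure_mix huv, by simp [hμ.2.1, hν.2.1], fun a b h₁ h₂ h₃ => ?_⟩
  simp only [Measure.add_apply, Measure.smul_apply, smul_eq_mul, (hμ.2.2 a b h₁ h₂ h₃).1,
    (hμ.2.2 a b h₁ h₂ h₃).2, (hν.2.2 a b h₁ h₂ h₃).1, (hν.2.2 a b h₁ h₂ h₃).2, ← add_mul, huv,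
    one_mul, and_self]

lemma IsStepPermutonN.mix {N : ℕ} (huv : u + v = 1) (hμ : IsStepPermutonN N μ)
    (hν : IsStepPermutonN N ν) : IsStepPermutonN N (u • μ + v • ν) := by
  refine ⟨hμ.1.mix huv hν.1, fun i hi j hj => ?_⟩
  obtain ⟨c, hc⟩ := hμ.2 i hi j hj
  obtain ⟨d, hd⟩ := hν.2 i hi j hj
  refine ⟨u * c + v * d, fun s hs hsm => ?_⟩
  simp only [Measure.add_apply, Measure.smul_apply, smul_eq_mul, hc s hs hsm, hd s hs hsm]
  ring

lemma IsStepPermuton.mix (huv : u + v = 1) (hμ : IsStepPermuton μ) (hν : IsStepPermuton ν) :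
    IsStepPermuton (u • μ + v • ν) := by
  obtain ⟨N, hN, hμ⟩ := hμ
  obtain ⟨M, hM, hν⟩ := hν
  refine ⟨N * M, Nat.mul_pos hN hM, (hμ.mul hN hM).mix huv ?_⟩
  rw [mul_comm]
  exact hν.mul hM hN

lemma SubUniformDiag.mix (huv : u + v = 1) (hμ : SubUniformDiag μ) (hν : SubUniformDiag ν) :
    SubUniformDiag (u • μ + v • ν) := by
  have aux : ∀ {x y z : ℝ≥0∞}, x ≤ z → y ≤ z → u * x + v * y ≤ z := fun {x y z} hx hy =>
    calc u * x + v * y ≤ u * z + v * z := by gcongr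
      _ = z := by rw [← add_mul, huv, one_mul]
  intro a b h₁ h₂ h₃
  simp only [Measure.add_apply, Measure.smul_apply, smul_eq_mul]
  exact ⟨aux (hμ a b h₁ h₂ h₃).1 (hν a b h₁ h₂ h₃).1, aux (hμ a b h₁ h₂ h₃).2 (hν a b h₁ h₂ h₃).2⟩

lemma mix_mem_queenons {γ₁ γ₂ : ProbabilityMeasure (ℝ × ℝ)} (h₁ : γ₁ ∈ queenons)
    (h₂ : γ₂ ∈ queenons) {t : ℝ} (ht₀ : 0 ≤ t) (ht₁ : t ≤ 1) :
    ∃ h : IsProbabilityMeasure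
        (ENNReal.ofReal t • γ₁.toMeasure + ENNReal.ofReal (1 - t) • γ₂.toMeasure),
      (⟨ENNReal.ofReal t • γ₁.toMeasure + ENNReal.ofReal (1 - t) • γ₂.toMeasure, h⟩ :
        ProbabilityMeasure (ℝ × ℝ)) ∈ queenons := by
  have huv : ENNReal.ofReal t + ENNReal.ofReal (1 - t) = 1 := by
    rw [← ENNReal.ofReal_add ht₀ (by linarith)]
    simp
  let F : ProbabilityMeasure (ℝ × ℝ) → ProbabilityMeasure (ℝ × ℝ) →
      ProbabilityMeasure (ℝ × ℝ) := fun μ ν =>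
    ⟨ENNReal.ofReal t • μ.toMeasure + ENNReal.ofReal (1 - t) • ν.toMeasure,
      isProbabilityMeasure_mix huv⟩
  have hF : Continuous (Function.uncurry F) := by
    rw [(ProbabilityMeasure.toFiniteMeasure_isEmbedding (ℝ × ℝ)).continuous_iff]
    have : ProbabilityMeasure.toFiniteMeasure ∘ Function.uncurry F = fun p =>
        t.toNNReal • p.1.toFiniteMeasure + (1 - t).toNNReal • p.2.toFiniteMeasure := by
      funext p
      exact Subtype.ext rfl
    rw [this]
    have hc := (ProbabilityMeasure.toFiniteMeasure_isEmbedding (ℝ × ℝ)).continuous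
    exact ((hc.comp continuous_fst).const_smul t.toNNReal).add
      ((hc.comp continuous_snd).const_smul (1 - t).toNNReal)
  exact ⟨isProbabilityMeasure_mix huv, map_mem_closure₂ hF h₁ h₂ fun a ha b hb =>
    ⟨ha.1.mix huv hb.1, ha.2.mix huv hb.2⟩⟩

end Convex

/-- **Claim (queenons form a compact convex metric space).**
`d` is a metric on the Borel probability measures on the square, `Γ` is convex,
`(Γ, d)` is (sequentially) compact, and on `Γ` convergence in `d` coincides with weak
convergence of probability measures. -/
theorem queenons_compact_convex_metric :
    (∀ μ ν ρ : ProbabilityMeasure (ℝ × ℝ),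
      μ.toMeasure unitSqᶜ = 0 → ν.toMeasure unitSqᶜ = 0 → ρ.toMeasure unitSqᶜ = 0 →
        0 ≤ qdist μ.toMeasure ν.toMeasure ∧
        qdist μ.toMeasure μ.toMeasure = 0 ∧
        qdist μ.toMeasure ν.toMeasure = qdist ν.toMeasure μ.toMeasure ∧
        qdist μ.toMeasure ρ.toMeasure ≤
          qdist μ.toMeasure ν.toMeasure + qdist ν.toMeasure ρ.toMeasure ∧
        (qdist μ.toMeasure ν.toMeasure = 0 → μ = ν)) ∧
    (∀ γ₁ ∈ queenons, ∀ γ₂ ∈ queenons, ∀ t : ℝ, 0 ≤ t → t ≤ 1 →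
      ∃ h : IsProbabilityMeasure
          (ENNReal.ofReal t • (γ₁ : ProbabilityMeasure (ℝ × ℝ)).toMeasure +
            ENNReal.ofReal (1 - t) • (γ₂ : ProbabilityMeasure (ℝ × ℝ)).toMeasure),
        (⟨ENNReal.ofReal t • γ₁.toMeasure + ENNReal.ofReal (1 - t) • γ₂.toMeasure, h⟩ :
          ProbabilityMeasure (ℝ × ℝ)) ∈ queenons) ∧
    (∀ f : ℕ → ProbabilityMeasure (ℝ × ℝ), (∀ n, f n ∈ queenons) →
      ∃ γ ∈ queenons, ∃ φ : ℕ → ℕ, StrictMono φ ∧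
        Tendsto (fun k => qdist (f (φ k)).toMeasure γ.toMeasure) atTop (𝓝 0)) ∧
    (∀ f : ℕ → ProbabilityMeasure (ℝ × ℝ), ∀ γ : ProbabilityMeasure (ℝ × ℝ),
      (∀ n, f n ∈ queenons) → γ ∈ queenons →
        (Tendsto (fun n => qdist (f n).toMeasure γ.toMeasure) atTop (𝓝 0) ↔
          Tendsto f atTop (𝓝 γ))) := by
  refine ⟨fun μ ν ρ hμ hν _ => ⟨qdist_nonneg, qdist_self, qdist_comm, qdist_triangle,
      fun h => ProbabilityMeasure.toMeasure_injective (eq_of_qdist_eq_zero hμ hν h)⟩,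
    fun γ₁ h₁ γ₂ h₂ t ht₀ ht₁ => mix_mem_queenons h₁ h₂ ht₀ ht₁, fun f hf => ?_,
    fun f γ hf hγ => ⟨tendsto_of_tendsto_qdist hf hγ, fun h =>
      tendsto_qdist_of_tendsto h fun n => isDiagBounded_of_mem_queenons (hf n)⟩⟩
  obtain ⟨γ, hγ, φ, hφ, hlim⟩ := exists_subseq_tendsto_queenons hf
  exact ⟨γ, hγ, φ, hφ, tendsto_qdist_of_tendsto hlim
    fun n => isDiagBounded_of_mem_queenons (hf (φ n))⟩

end
end

section
/- For every queenon γ, the limit as N → ∞ of H_q^N(γ) exists and equals H_q(γ) (as an equality in the extended reals: if H_q(γ) = −∞ then H_q^N(γ) → −∞). -/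
open MeasureTheory Filter Topology
open scoped ENNReal

noncomputable section

section PartitionEntropy

variable {X κ : Type*} [MeasurableSpace X]

/-- The divergence of `μ` from `ν` along the finite family of cells `C i`, `i ∈ s`. -/
def cellDivergence (s : Finset κ) (C : κ → Set X) (μ ν : Measure X) : ℝ :=
  ∑ i ∈ s, μ.real (C i) * Real.log (μ.real (C i) / ν.real (C i))

/-- The variational functional whose supremum over `g` is the divergence of `μ` from `ν`. -/
def dualDivergence (μ ν : Measure X) (g : X → ℝ) : ℝ :=
  ∫ x, g x ∂μ - ∫ x, Real.exp (g x - 1) ∂ν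

lemma sum_restrict_eq_of_aedisjoint_of_cover {s : Finset κ} {C : κ → Set X} {m : Measure X}
    (hC : ∀ i ∈ s, MeasurableSet (C i)) (hd : (s : Set κ).Pairwise (Function.onFun (AEDisjoint m) C))
    (hcover : m (⋃ i ∈ s, C i)ᶜ = 0) : ∑ i ∈ s, m.restrict (C i) = m := by
  ext t ht
  have hu : m t = m (⋃ i ∈ s, t ∩ C i) := by
    rw [← Set.inter_iUnion₂]
    refine (measure_inter_conull ?_).symm
    simpa using hcover
  rw [hu, measure_biUnion_finset₀]
  · simp [Measure.restrict_apply ht]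
  · intro i hi j hj hij
    exact (hd hi hj hij).mono Set.inter_subset_right Set.inter_subset_right
  · exact fun i hi => (ht.inter (hC i hi)).nullMeasurableSet

lemma sum_setIntegral_eq_integral {s : Finset κ} {C : κ → Set X} {m : Measure X}
    (hm : ∑ i ∈ s, m.restrict (C i) = m) {g : X → ℝ} (hg : Integrable g m) :
    ∑ i ∈ s, ∫ x in C i, g x ∂m = ∫ x, g x ∂m := by
  rw [← integral_finsetSum_measure fun i _ => hg.restrict, hm]

/-- Young's inequality for `t ↦ t log t` and its conjugate `u ↦ exp (u - 1)`, homogenized. -/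
lemma mul_sub_mul_exp_le_mul_log_div {a b : ℝ} (ha : 0 ≤ a) (hb : 0 ≤ b) (h : b = 0 → a = 0)
    (u : ℝ) : a * u - b * Real.exp (u - 1) ≤ a * Real.log (a / b) := by
  rcases ha.eq_or_lt with rfl | ha
  · have := mul_nonneg hb (Real.exp_pos (u - 1)).le
    simpa using this
  have hb : 0 < b := hb.lt_of_ne fun hb0 => ha.ne' (h hb0.symm)
  have h1 := Real.add_one_le_exp (u - 1 - Real.log (a / b))
  rw [Real.exp_sub, Real.exp_log (by positivity), div_div_eq_mul_div, le_div_iff₀ ha] at h1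
  linarith

lemma le_cellDivergence_of_oscillation {s : Finset κ} {C : κ → Set X} {μ ν : Measure X}
    [IsFiniteMeasure μ] [IsFiniteMeasure ν] (hC : ∀ i ∈ s, MeasurableSet (C i))
    (hμ : ∑ i ∈ s, μ.restrict (C i) = μ) (hν : ∑ i ∈ s, ν.restrict (C i) = ν)
    (hnull : ∀ i ∈ s, ν (C i) = 0 → μ (C i) = 0) {g : X → ℝ} (hgμ : Integrable g μ)
    (hgν : Integrable (fun x => Real.exp (g x - 1)) ν) {ε : ℝ}
    (hosc : ∀ i ∈ s, ∀ x ∈ C i, ∀ y ∈ C i, g x ≤ g y + ε) :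
    ∫ x, g x ∂μ - ε * μ.real Set.univ - Real.exp ε * ∫ x, Real.exp (g x - 1) ∂ν
      ≤ cellDivergence s C μ ν := by
  have huniv : ∑ i ∈ s, μ.real (C i) = μ.real Set.univ := by
    simpa using sum_setIntegral_eq_integral hμ (integrable_const (1 : ℝ))
  rw [← sum_setIntegral_eq_integral hμ hgμ, ← sum_setIntegral_eq_integral hν hgν, ← huniv,
    Finset.mul_sum, Finset.mul_sum, ← Finset.sum_sub_distrib, ← Finset.sum_sub_distrib]
  refine Finset.sum_le_sum fun i hi => ?_
  rcases (C i).eq_empty_or_nonempty with he | ⟨y, hy⟩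
  · simp [he]
  have h1 : ∫ x in C i, g x ∂μ ≤ μ.real (C i) * (g y + ε) := by
    have := setIntegral_mono_on hgμ.integrableOn (integrable_const (g y + ε)).integrableOn
      (hC i hi) fun x hx => hosc i hi x hx y hy
    simpa using this
  have h2 : ν.real (C i) * Real.exp (g y - 1)
      ≤ Real.exp ε * ∫ x in C i, Real.exp (g x - 1) ∂ν := by
    have := setIntegral_mono_on (integrable_const (Real.exp (g y - 1))).integrableOn
      (hgν.const_mul (Real.exp ε)).integrableOn (hC i hi) fun x hx => by
        rw [← Real.exp_add]
        exact Real.exp_le_exp.mpr (by linarith [hosc i hi y hy x hx])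
    simpa [integral_const_mul] using this
  have h3 := mul_sub_mul_exp_le_mul_log_div (a := μ.real (C i)) (b := ν.real (C i))
    measureReal_nonneg measureReal_nonneg
    (by simpa [measureReal_eq_zero_iff] using hnull i hi) (g y)
  linarith

/-- The log-sum inequality: coarsening to cells does not increase the divergence. -/
lemma cellDivergence_le_integral_log {s : Finset κ} {C : κ → Set X} {μ ν : Measure X}
    [IsFiniteMeasure μ] [IsFiniteMeasure ν] (hC : ∀ i ∈ s, MeasurableSet (C i))
    (hμ : ∑ i ∈ s, μ.restrict (C i) = μ) (hac : μ ≪ ν)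
    (hint : Integrable (fun x => Real.log (μ.rnDeriv ν x).toReal) μ) :
    cellDivergence s C μ ν ≤ ∫ x, Real.log (μ.rnDeriv ν x).toReal ∂μ := by
  rw [← sum_setIntegral_eq_integral hμ hint]
  refine Finset.sum_le_sum fun i hi => ?_
  rcases measureReal_nonneg (μ := μ) (s := C i) |>.eq_or_lt with h0 | hpos
  · have : μ (C i) = 0 := by simpa [measureReal_eq_zero_iff] using h0.symm
    simp [Measure.restrict_eq_zero.mpr this, ← h0]
  have hνpos : 0 < ν.real (C i) := by
    refine measureReal_nonneg.lt_of_ne fun h => hpos.ne' ?_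
    rw [eq_comm, measureReal_eq_zero_iff] at h
    rw [measureReal_eq_zero_iff]
    exact hac h
  set c := μ.real (C i) / ν.real (C i) with hc
  have hcpos : 0 < c := by positivity
  have hφ : Integrable
      (fun x => (μ.rnDeriv ν x).toReal * Real.log (μ.rnDeriv ν x).toReal) ν :=
    (integrable_toReal_rnDeriv_mul_iff hac).mpr hint
  have hf : Integrable (fun x => (μ.rnDeriv ν x).toReal) ν := Measure.integrable_toReal_rnDeriv
  have key := setIntegral_mono (s := C i)
    ((hf.mul_const (Real.log c + 1)).sub (integrable_const c)).integrableOn hφ.integrableOn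
    fun x => by
      have := mul_sub_mul_exp_le_mul_log_div (a := (μ.rnDeriv ν x).toReal) (b := 1)
        ENNReal.toReal_nonneg zero_le_one (by simp) (Real.log c + 1)
      simpa [Real.exp_log hcpos] using this
  have hl : ∫ x in C i, (μ.rnDeriv ν x).toReal * Real.log (μ.rnDeriv ν x).toReal ∂ν
      = ∫ x in C i, Real.log (μ.rnDeriv ν x).toReal ∂μ :=
    setIntegral_rnDeriv_smul hac (hC i hi)
  rw [hl] at key
  refine le_trans (le_of_eq ?_) key
  have hfC : ∫ x in C i, (μ.rnDeriv ν x).toReal ∂ν = μ.real (C i) :=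
    Measure.setIntegral_toReal_rnDeriv hac _
  simp only [Pi.sub_apply]
  rw [integral_sub (hf.mul_const _).integrableOn (integrable_const c).integrableOn,
    integral_mul_const, hfC]
  simp only [integral_const, measureReal_restrict_apply_univ, smul_eq_mul]
  rw [show ν.real (C i) * c = μ.real (C i) by rw [hc]; field_simp]
  ring


lemma integrable_of_bounded {m : Measure X} [IsFiniteMeasure m] {g : X → ℝ} (hg : Measurable g)
    {M : ℝ} (hM : ∀ x, |g x| ≤ M) : Integrable g m :=
  Integrable.of_bound hg.aestronglyMeasurable M (ae_of_all _ hM)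

lemma integrable_exp_sub_one_of_bounded {m : Measure X} [IsFiniteMeasure m] {g : X → ℝ}
    (hg : Measurable g) {M : ℝ} (hM : ∀ x, |g x| ≤ M) :
    Integrable (fun x => Real.exp (g x - 1)) m := by
  refine integrable_of_bounded (M := Real.exp M) (by fun_prop) fun x => ?_
  rw [Real.abs_exp]
  exact Real.exp_le_exp.mpr (by linarith [(abs_le.mp (hM x)).2])

lemma absolutelyContinuous_of_dualDivergence_le {μ ν : Measure X} [IsFiniteMeasure μ]
    [IsFiniteMeasure ν] {c : ℝ}
    (h : ∀ g : X → ℝ, Measurable g → ∀ M, (∀ x, |g x| ≤ M) → dualDivergence μ ν g ≤ c) :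
    μ ≪ ν := by
  refine Measure.AbsolutelyContinuous.mk fun A hA hνA => ?_
  by_contra hμA
  have hpos : 0 < μ.real A := measureReal_nonneg.lt_of_ne fun h0 => hμA <| by
    simpa [measureReal_eq_zero_iff] using h0.symm
  set M : ℝ := (c + Real.exp (-1) * ν.real Set.univ + 1) / μ.real A with hM
  have hF := h (A.indicator fun _ => M) (measurable_const.indicator hA) |M| fun x => by
    by_cases hx : x ∈ A <;> simp [hx]
  have h1 : ∫ x, A.indicator (fun _ => M) x ∂μ = c + Real.exp (-1) * ν.real Set.univ + 1 := by
    rw [integral_indicator hA, setIntegral_const, smul_eq_mul, hM]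
    field_simp
  have h2 : ∫ x, Real.exp (A.indicator (fun _ => M) x - 1) ∂ν
      = Real.exp (-1) * ν.real Set.univ := by
    have : (fun x => Real.exp (A.indicator (fun _ => M) x - 1)) =ᵐ[ν] fun _ => Real.exp (-1) := by
      filter_upwards [measure_eq_zero_iff_ae_notMem.mp hνA] with x hx
      simp [hx]
    rw [integral_congr_ae this]
    simp [mul_comm]
  rw [dualDivergence, h1, h2] at hF
  linarith

/-- Truncation of a nonnegative number to `[1 / (k + 1), k + 1]`. -/
def truncDensity (k : ℕ) (t : ℝ) : ℝ := max (1 / ((k : ℝ) + 1)) (min t ((k : ℝ) + 1))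

lemma truncDensity_pos (k : ℕ) (t : ℝ) : 0 < truncDensity k t :=
  lt_max_of_lt_left (by positivity)

lemma measurable_truncDensity (k : ℕ) : Measurable (truncDensity k) := by
  unfold truncDensity
  fun_prop

lemma abs_one_add_log_truncDensity_le (k : ℕ) (t : ℝ) :
    |1 + Real.log (truncDensity k t)| ≤ 1 + Real.log ((k : ℝ) + 1) := by
  have hk : (1 : ℝ) ≤ (k : ℝ) + 1 := by simp
  have hlo : 1 / ((k : ℝ) + 1) ≤ truncDensity k t := le_max_left _ _
  have hhi : truncDensity k t ≤ (k : ℝ) + 1 :=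
    max_le (by rw [div_le_iff₀ (by positivity)]; nlinarith) (min_le_right _ _)
  have h1 := Real.log_le_log (by positivity) hlo
  rw [one_div, Real.log_inv] at h1
  have h2 := Real.log_le_log (truncDensity_pos k t) hhi
  rw [abs_le]
  constructor <;> linarith

lemma tendsto_truncDensity {t : ℝ} (ht : 0 ≤ t) :
    Tendsto (fun k => truncDensity k t) atTop (𝓝 t) := by
  have h1 : Tendsto (fun k : ℕ => min t ((k : ℝ) + 1)) atTop (𝓝 t) := by
    refine tendsto_const_nhds.congr' ?_
    filter_upwards [eventually_ge_atTop ⌈t⌉₊] with k hk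
    have := Nat.ceil_le.mp hk
    rw [min_eq_left (by linarith)]
  have h2 := (tendsto_one_div_add_atTop_nhds_zero_nat (𝕜 := ℝ)).max h1
  rwa [max_eq_right ht] at h2

lemma tendsto_mul_log_truncDensity {t : ℝ} (ht : 0 ≤ t) :
    Tendsto (fun k => t * (1 + Real.log (truncDensity k t)) - truncDensity k t) atTop
      (𝓝 (t * Real.log t)) := by
  have h := tendsto_truncDensity ht
  rcases ht.eq_or_lt with rfl | hpos
  · simpa using h.neg
  · have := (((Real.continuousAt_log hpos.ne').tendsto.comp h).const_add 1 |>.const_mul t).sub h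
    rwa [mul_add, mul_one, add_sub_cancel_left] at this

lemma neg_one_le_mul_log_truncDensity (k : ℕ) {t : ℝ} (ht : 0 ≤ t) :
    -1 ≤ t * (1 + Real.log (truncDensity k t)) - truncDensity k t := by
  have hk : (1 : ℝ) ≤ (k : ℝ) + 1 := by simp
  have hinv : 1 / ((k : ℝ) + 1) ≤ 1 := by rw [div_le_one (by positivity)]; exact hk
  have hpos := truncDensity_pos k t
  rcases le_or_gt t ((k : ℝ) + 1) with hle | hgt
  · have hT : truncDensity k t = max (1 / ((k : ℝ) + 1)) t := by
      rw [truncDensity, min_eq_left hle]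
    have hlog := mul_le_mul_of_nonneg_left (Real.one_sub_inv_le_log_of_pos hpos) ht
    have hge : t ≤ truncDensity k t := hT ▸ le_max_right _ _
    have hdiv : t * (truncDensity k t)⁻¹ ≤ 1 := by
      rw [← div_eq_mul_inv, div_le_one hpos]
      exact hge
    rcases le_total (1 / ((k : ℝ) + 1)) t with h | h
    · rw [max_eq_right h] at hT
      rw [hT] at hlog hdiv ⊢
      nlinarith
    · rw [max_eq_left h] at hT
      have hle1 : truncDensity k t ≤ 1 := hT ▸ hinv
      have hid : t * (truncDensity k t)⁻¹ * truncDensity k t = t := by field_simp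
      have hnn : 0 ≤ t * (truncDensity k t)⁻¹ := by positivity
      nlinarith [mul_nonneg (sub_nonneg.mpr hdiv) (sub_nonneg.mpr hle1), mul_nonneg hnn hpos.le]
  · have hT : truncDensity k t = (k : ℝ) + 1 := by
      rw [truncDensity, min_eq_right hgt.le, max_eq_right (hinv.trans hk)]
    rw [hT]
    nlinarith [mul_nonneg ht (Real.log_nonneg hk)]

lemma DKL_le_of_dualDivergence_le {μ ν : Measure X} [IsFiniteMeasure μ] [IsFiniteMeasure ν]
    {c : ℝ}
    (h : ∀ g : X → ℝ, Measurable g → ∀ M, (∀ x, |g x| ≤ M) → dualDivergence μ ν g ≤ c) :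
    DKL μ ν ≤ c := by
  have hac := absolutelyContinuous_of_dualDivergence_le h
  set f : X → ℝ := fun x => (μ.rnDeriv ν x).toReal with hf
  have hfm : Measurable f := (Measure.measurable_rnDeriv μ ν).ennreal_toReal
  have hf0 : ∀ x, 0 ≤ f x := fun x => ENNReal.toReal_nonneg
  set w : ℕ → X → ℝ := fun k x =>
    f x * (1 + Real.log (truncDensity k (f x))) - truncDensity k (f x) with hw
  have hgm : ∀ k, Measurable fun x => 1 + Real.log (truncDensity k (f x)) := fun k =>
    ((measurable_truncDensity k).comp hfm).log.const_add 1
  have hexp : ∀ k x, Real.exp (1 + Real.log (truncDensity k (f x)) - 1)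
      = truncDensity k (f x) := fun k x => by
    rw [add_sub_cancel_left, Real.exp_log (truncDensity_pos _ _)]
  have hint1 : ∀ k, Integrable (fun x => f x * (1 + Real.log (truncDensity k (f x)))) ν := fun k =>
    (integrable_toReal_rnDeriv_mul_iff hac).mpr
      (integrable_of_bounded (hgm k) fun x => abs_one_add_log_truncDensity_le k (f x))
  have hint2 : ∀ k, Integrable (fun x => truncDensity k (f x)) ν := fun k => by
    have := integrable_exp_sub_one_of_bounded (m := ν) (hgm k)
      fun x => abs_one_add_log_truncDensity_le k (f x)
    simpa only [hexp] using this
  have hwint : ∀ k, Integrable (w k) ν := fun k => (hint1 k).sub (hint2 k)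
  have hwc : ∀ k, ∫ x, w k x ∂ν ≤ c := fun k => by
    have := h _ (hgm k) _ fun x => abs_one_add_log_truncDensity_le k (f x)
    simp only [dualDivergence, hexp] at this
    rwa [hw, integral_sub (hint1 k) (hint2 k), hf, integral_toReal_rnDeriv_mul hac]
  have hw1 : ∀ k x, 0 ≤ w k x + 1 := fun k x => by
    linarith [neg_one_le_mul_log_truncDensity k (hf0 x)]
  have hint_add : ∀ k, ∫ x, (w k x + 1) ∂ν ≤ c + ν.real Set.univ := fun k => by
    rw [integral_add (hwint k) (integrable_const 1)]
    simpa using hwc k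
  have hφ1 : ∀ x, 0 ≤ f x * Real.log (f x) + 1 := fun x =>
    ge_of_tendsto' ((tendsto_mul_log_truncDensity (hf0 x)).add_const 1) fun k => hw1 k x
  have hfatou : ∫⁻ x, ENNReal.ofReal (f x * Real.log (f x) + 1) ∂ν
      ≤ ENNReal.ofReal (c + ν.real Set.univ) := by
    calc ∫⁻ x, ENNReal.ofReal (f x * Real.log (f x) + 1) ∂ν
        = ∫⁻ x, liminf (fun k => ENNReal.ofReal (w k x + 1)) atTop ∂ν := by
          refine lintegral_congr fun x => Eq.symm ?_
          exact (ENNReal.tendsto_ofReal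
            ((tendsto_mul_log_truncDensity (hf0 x)).add_const 1)).liminf_eq
      _ ≤ liminf (fun k => ∫⁻ x, ENNReal.ofReal (w k x + 1) ∂ν) atTop := by
          refine lintegral_liminf_le' fun k => ?_
          exact ((hwint k).aemeasurable.add_const 1).ennreal_ofReal
      _ ≤ ENNReal.ofReal (c + ν.real Set.univ) := by
          refine liminf_le_of_frequently_le' (Frequently.of_forall fun k => ?_)
          rw [← ofReal_integral_eq_lintegral_ofReal ((integrable_add_const_iff).mpr (hwint k))
            (ae_of_all _ (hw1 k))]
          exact ENNReal.ofReal_le_ofReal (hint_add k)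
  have hφint1 : Integrable (fun x => f x * Real.log (f x) + 1) ν := by
    refine ⟨((hfm.mul hfm.log).add_const 1).aestronglyMeasurable, ?_⟩
    rw [hasFiniteIntegral_iff_ofReal (ae_of_all _ hφ1)]
    exact hfatou.trans_lt ENNReal.ofReal_lt_top
  have hφint : Integrable (fun x => f x * Real.log (f x)) ν :=
    integrable_add_const_iff.mp hφint1
  have hlog : Integrable (fun x => Real.log (μ.rnDeriv ν x).toReal) μ :=
    (integrable_toReal_rnDeriv_mul_iff hac).mp hφint
  have hcν : 0 ≤ c + ν.real Set.univ := (integral_nonneg (hw1 0)).trans (hint_add 0)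
  rw [← ofReal_integral_eq_lintegral_ofReal hφint1 (ae_of_all _ hφ1),
    ENNReal.ofReal_le_ofReal_iff hcν, integral_add hφint (integrable_const 1)] at hfatou
  have hle : ∫ x, f x * Real.log (f x) ∂ν ≤ c := by simpa using hfatou
  rw [hf, integral_toReal_rnDeriv_mul hac] at hle
  rw [DKL, if_pos ⟨hac, hlog⟩]
  exact_mod_cast hle

lemma dualDivergence_le_add_of_close {μ ν : Measure X} [IsFiniteMeasure μ] [IsFiniteMeasure ν]
    {g g' : X → ℝ} {M : ℝ} (hg : Measurable g) (hg' : Measurable g') (hM : ∀ x, |g x| ≤ M)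
    (hM' : ∀ x, |g' x| ≤ M) :
    dualDivergence μ ν g
      ≤ dualDivergence μ ν g' + (1 + Real.exp M) * ∫ x, |g x - g' x| ∂(μ + ν) := by
  have hd : ∀ m : Measure X, IsFiniteMeasure m → Integrable (fun x => |g x - g' x|) m := fun m _ =>
    ((integrable_of_bounded hg hM).sub (integrable_of_bounded hg' hM')).abs
  have h1 : ∫ x, g x ∂μ ≤ ∫ x, g' x ∂μ + ∫ x, |g x - g' x| ∂μ := by
    rw [← integral_add (integrable_of_bounded hg' hM') (hd μ inferInstance)]
    refine integral_mono (integrable_of_bounded hg hM)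
      ((integrable_of_bounded hg' hM').add (hd μ inferInstance)) fun x => ?_
    beta_reduce
    linarith [le_abs_self (g x - g' x)]
  have h2 : ∫ x, Real.exp (g' x - 1) ∂ν
      ≤ ∫ x, Real.exp (g x - 1) ∂ν + Real.exp M * ∫ x, |g x - g' x| ∂ν := by
    rw [← integral_const_mul, ← integral_add (integrable_exp_sub_one_of_bounded hg hM)
      ((hd ν inferInstance).const_mul _)]
    refine integral_mono (integrable_exp_sub_one_of_bounded hg' hM')
      ((integrable_exp_sub_one_of_bounded hg hM).add ((hd ν inferInstance).const_mul _))
      fun x => ?_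
    beta_reduce
    have e1 := Real.add_one_le_exp (g x - g' x)
    have e2 : Real.exp (g x - 1) = Real.exp (g' x - 1) * Real.exp (g x - g' x) := by
      rw [← Real.exp_add]; ring_nf
    have e3 : Real.exp (g' x - 1) ≤ Real.exp M :=
      Real.exp_le_exp.mpr (by linarith [(abs_le.mp (hM' x)).2])
    have e4 := mul_le_mul_of_nonneg_left e1 (Real.exp_pos (g' x - 1)).le
    have e5 := mul_le_mul_of_nonneg_right e3 (abs_nonneg (g x - g' x))
    have e6 := mul_le_mul_of_nonneg_left (neg_abs_le (g x - g' x)) (Real.exp_pos (g' x - 1)).le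
    rw [e2]
    linarith
  have hμ0 : 0 ≤ ∫ x, |g x - g' x| ∂μ := integral_nonneg fun x => abs_nonneg _
  have hν0 : 0 ≤ ∫ x, |g x - g' x| ∂ν := integral_nonneg fun x => abs_nonneg _
  rw [integral_add_measure (hd μ inferInstance) (hd ν inferInstance)]
  unfold dualDivergence
  nlinarith [mul_nonneg (Real.exp_pos M).le hμ0]

lemma exists_uniformContinuous_dualDivergence_close [MetricSpace X] [ProperSpace X]
    [BorelSpace X] {μ ν : Measure X} [IsFiniteMeasure μ] [IsFiniteMeasure ν] {g : X → ℝ}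
    {M : ℝ} (hg : Measurable g) (hM : ∀ x, |g x| ≤ M) {ε : ℝ} (hε : 0 < ε) :
    ∃ g' : X → ℝ, UniformContinuous g' ∧ (∀ x, |g' x| ≤ M) ∧
      dualDivergence μ ν g ≤ dualDivergence μ ν g' + ε := by
  obtain ⟨g₀, hsupp, hle, hcont, hint⟩ :=
    (integrable_of_bounded (m := μ + ν) hg hM).exists_hasCompactSupport_integral_sub_le
      (div_pos hε (by positivity : 0 < 1 + Real.exp M))
  have huc : UniformContinuous g₀ := hsupp.uniformContinuous_of_continuous hcont
  have hlip : ∀ a b : ℝ, |max (-M) (min a M) - max (-M) (min b M)| ≤ |a - b| := fun a b => by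
    have h1 := abs_max_sub_max_le_abs (min a M) (min b M) (-M)
    have h2 := abs_min_sub_min_le_max a M b M
    rw [max_comm (-M), max_comm (-M)]
    refine h1.trans (h2.trans ?_)
    simp
  have hbd : ∀ x, |max (-M) (min (g₀ x) M)| ≤ M := fun x => by
    have hM0 : 0 ≤ M := (abs_nonneg _).trans (hM x)
    exact abs_le.mpr ⟨le_max_left _ _, max_le (by linarith) (min_le_right _ _)⟩
  have huc' : UniformContinuous fun x => max (-M) (min (g₀ x) M) := by
    rw [Metric.uniformContinuous_iff] at huc ⊢
    intro r hr
    obtain ⟨δ, hδ, hd⟩ := huc r hr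
    exact ⟨δ, hδ, fun a b hab => (hlip _ _).trans_lt (hd hab)⟩
  refine ⟨fun x => max (-M) (min (g₀ x) M), huc', hbd, ?_⟩
  refine (dualDivergence_le_add_of_close hg huc'.continuous.measurable hM hbd).trans ?_
  gcongr
  have hmono : ∫ x, |g x - max (-M) (min (g₀ x) M)| ∂(μ + ν) ≤ ∫ x, ‖g x - g₀ x‖ ∂(μ + ν) := by
    refine integral_mono ((integrable_of_bounded hg hM).sub
      (integrable_of_bounded huc'.continuous.measurable hbd)).abs
      ((integrable_of_bounded hg hM).sub hint).norm fun x => ?_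
    have := hlip (g x) (g₀ x)
    rwa [min_eq_left (abs_le.mp (hM x)).2, max_eq_right (abs_le.mp (hM x)).1] at this
  calc (1 + Real.exp M) * ∫ x, |g x - max (-M) (min (g₀ x) M)| ∂(μ + ν)
      ≤ (1 + Real.exp M) * (ε / (1 + Real.exp M)) := by gcongr; exact hmono.trans hle
    _ = ε := by field_simp

/-- A sequence of finite partitions (up to null sets) whose mesh tends to zero, with every
`ν`-null cell being `μ`-null. -/
structure IsShrinkingPartition [MetricSpace X] (s : ℕ → Finset κ) (C : ℕ → κ → Set X)
    (μ ν : Measure X) : Prop where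
  measurableSet : ∀ N i, MeasurableSet (C N i)
  sum_restrict_left : ∀ᶠ N in atTop, ∑ i ∈ s N, μ.restrict (C N i) = μ
  sum_restrict_right : ∀ᶠ N in atTop, ∑ i ∈ s N, ν.restrict (C N i) = ν
  null : ∀ᶠ N in atTop, ∀ i ∈ s N, ν (C N i) = 0 → μ (C N i) = 0
  mesh : ∀ ε > 0, ∀ᶠ N in atTop, ∀ i ∈ s N, ∀ x ∈ C N i, ∀ y ∈ C N i, dist x y < ε

lemma IsShrinkingPartition.eventually_lt_cellDivergence [MetricSpace X] [ProperSpace X]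
    [BorelSpace X] {s : ℕ → Finset κ} {C : ℕ → κ → Set X} {μ ν : Measure X} [IsFiniteMeasure μ]
    [IsFiniteMeasure ν] (hP : IsShrinkingPartition s C μ ν) {g : X → ℝ} {M : ℝ}
    (hg : Measurable g) (hM : ∀ x, |g x| ≤ M) {c : ℝ} (hc : c < dualDivergence μ ν g) :
    ∀ᶠ N in atTop, c < cellDivergence (s N) (C N) μ ν := by
  obtain ⟨g', huc, hM', hclose⟩ := exists_uniformContinuous_dualDivergence_close
    (μ := μ) (ν := ν) hg hM (half_pos (sub_pos.mpr hc))
  have hlt : c < dualDivergence μ ν g' := by linarith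
  have hlim : Tendsto (fun ε : ℝ => ∫ x, g' x ∂μ - ε * μ.real Set.univ
      - Real.exp ε * ∫ x, Real.exp (g' x - 1) ∂ν) (𝓝[>] 0) (𝓝 (dualDivergence μ ν g')) := by
    refine tendsto_nhdsWithin_of_tendsto_nhds ?_
    have : Continuous fun ε : ℝ => ∫ x, g' x ∂μ - ε * μ.real Set.univ
      - Real.exp ε * ∫ x, Real.exp (g' x - 1) ∂ν := by fun_prop
    simpa [dualDivergence] using this.tendsto 0
  obtain ⟨ε, hεc, hε⟩ := ((hlim.eventually_const_lt hlt).and self_mem_nhdsWithin).exists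
  obtain ⟨δ, hδ, hosc⟩ := Metric.uniformContinuous_iff.mp huc ε hε
  filter_upwards [hP.sum_restrict_left, hP.sum_restrict_right, hP.null, hP.mesh δ hδ]
    with N h1 h2 h3 h4
  refine hεc.trans_le (le_cellDivergence_of_oscillation (fun i _ => hP.measurableSet N i) h1 h2 h3
    (integrable_of_bounded huc.continuous.measurable hM')
    (integrable_exp_sub_one_of_bounded huc.continuous.measurable hM') fun i hi x hx y hy => ?_)
  have := hosc (h4 i hi x hx y hy)
  rw [Real.dist_eq] at this
  linarith [le_abs_self (g' x - g' y)]

theorem IsShrinkingPartition.tendsto_cellDivergence [MetricSpace X] [ProperSpace X]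
    [BorelSpace X] {s : ℕ → Finset κ} {C : ℕ → κ → Set X} {μ ν : Measure X} [IsFiniteMeasure μ]
    [IsFiniteMeasure ν] (hP : IsShrinkingPartition s C μ ν) :
    Tendsto (fun N => ((cellDivergence (s N) (C N) μ ν : ℝ) : EReal)) atTop (𝓝 (DKL μ ν)) := by
  refine tendsto_order.mpr ⟨fun a ha => ?_, fun a ha => ?_⟩
  · obtain ⟨c, hac, hcD⟩ := EReal.lt_iff_exists_real_btwn.mp ha
    have : ∃ g : X → ℝ, Measurable g ∧ ∃ M, (∀ x, |g x| ≤ M) ∧ c < dualDivergence μ ν g := by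
      by_contra! hcon
      exact hcD.not_ge (DKL_le_of_dualDivergence_le hcon)
    obtain ⟨g, hg, M, hM, hc⟩ := this
    filter_upwards [hP.eventually_lt_cellDivergence hg hM hc] with N hN
    exact hac.trans (EReal.coe_lt_coe_iff.mpr hN)
  · rw [DKL] at ha
    split_ifs at ha with h
    · filter_upwards [hP.sum_restrict_left] with N hN
      exact lt_of_le_of_lt (EReal.coe_le_coe_iff.mpr (cellDivergence_le_integral_log
        (fun i _ => hP.measurableSet N i) hN h.1 h.2)) ha
    · exact absurd ha not_top_lt

lemma DKL_ne_bot (μ ν : Measure X) : DKL μ ν ≠ ⊥ := by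
  rw [DKL]
  split_ifs <;> simp

end PartitionEntropy

section Grid

lemma exists_grid_index {N : ℕ} (hN : 0 < N) {u : ℝ} (hu : u ∈ Set.Icc (-1 : ℝ) 1) :
    ∃ i ∈ Finset.Icc 1 (2 * N), -1 + ((i : ℝ) - 1) / N ≤ u ∧ u ≤ -1 + (i : ℝ) / N := by
  have hN' : (0 : ℝ) < N := by exact_mod_cast hN
  rcases hu.1.eq_or_lt with h | h
  · refine ⟨1, by simp; omega, ?_, ?_⟩
    · simp [← h]
    · rw [← h]
      simp
  have hpos : 0 < (u + 1) * N := mul_pos (by linarith) hN'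
  refine ⟨⌈(u + 1) * N⌉₊, ?_, ?_, ?_⟩
  · rw [Finset.mem_Icc]
    refine ⟨Nat.one_le_iff_ne_zero.mpr (Nat.ceil_pos.mpr hpos).ne', Nat.ceil_le.mpr ?_⟩
    push_cast
    nlinarith [hu.2]
  · have := Nat.ceil_lt_add_one hpos.le
    have h2 : ((⌈(u + 1) * N⌉₊ : ℝ) - 1) / N ≤ u + 1 := by
      rw [div_le_iff₀ hN']
      linarith
    linarith
  · have h2 : u + 1 ≤ (⌈(u + 1) * N⌉₊ : ℝ) / N := by
      rw [le_div_iff₀ hN']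
      exact Nat.le_ceil _
    linarith

lemma grid_inter_eq_of_lt {N i j : ℕ} {u : ℝ} (hij : i < j) (hi : u ≤ -1 + (i : ℝ) / N)
    (hj : -1 + ((j : ℝ) - 1) / N ≤ u) : u = -1 + (i : ℝ) / N := by
  have hc : (i : ℝ) ≤ (j : ℝ) - 1 := by
    have : (i : ℝ) + 1 ≤ j := by exact_mod_cast hij
    linarith
  have : (i : ℝ) / N ≤ ((j : ℝ) - 1) / N := by gcongr
  linarith

lemma grid_inter_eq_of_ne {N i j : ℕ} {u : ℝ} (hij : i ≠ j)
    (hi : -1 + ((i : ℝ) - 1) / N ≤ u ∧ u ≤ -1 + (i : ℝ) / N)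
    (hj : -1 + ((j : ℝ) - 1) / N ≤ u ∧ u ≤ -1 + (j : ℝ) / N) :
    u = -1 + (i : ℝ) / N ∨ u = -1 + (j : ℝ) / N := by
  rcases hij.lt_or_gt with h | h
  · exact Or.inl (grid_inter_eq_of_lt h hi.2 hj.1)
  · exact Or.inr (grid_inter_eq_of_lt h hj.2 hi.1)

lemma abs_sub_le_of_mem_grid {N i : ℕ} {u v : ℝ}
    (hu : -1 + ((i : ℝ) - 1) / N ≤ u ∧ u ≤ -1 + (i : ℝ) / N)
    (hv : -1 + ((i : ℝ) - 1) / N ≤ v ∧ v ≤ -1 + (i : ℝ) / N) :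
    |u - v| ≤ 1 / (N : ℝ) := by
  have := sub_div (i : ℝ) 1 N
  rw [abs_le]
  constructor <;> linarith [hu.1, hu.2, hv.1, hv.2]

lemma eventually_one_div_natCast_lt {ε : ℝ} (hε : 0 < ε) : ∀ᶠ N : ℕ in atTop, 1 / (N : ℝ) < ε :=
  tendsto_one_div_atTop_nhds_zero_nat.eventually_lt_const hε

lemma sum_restrict_JNcell {m : Measure ℝ} (hm : m ≪ volume.restrict (Set.Icc (-1 : ℝ) 1)) {N : ℕ}
    (hN : 0 < N) : ∑ i ∈ Finset.Icc 1 (2 * N), m.restrict (JNcell N i) = m := by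
  have hpt : ∀ x : ℝ, m {x} = 0 := fun x => hm (measure_singleton x)
  refine sum_restrict_eq_of_aedisjoint_of_cover (fun i _ => measurableSet_Icc) ?_ ?_
  · intro i _ j _ hij
    refine measure_mono_null (t := {-1 + (i : ℝ) / N} ∪ {-1 + (j : ℝ) / N}) ?_
      (measure_union_null (hpt _) (hpt _))
    exact fun u hu => grid_inter_eq_of_ne hij hu.1 hu.2
  · refine measure_mono_null (t := (Set.Icc (-1 : ℝ) 1)ᶜ) (Set.compl_subset_compl.mpr ?_)
      (hm (by simp [Measure.restrict_apply measurableSet_Icc.compl]))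
    intro u hu
    obtain ⟨i, hi, h⟩ := exists_grid_index hN hu
    exact Set.mem_iUnion₂.mpr ⟨i, hi, h⟩

lemma unif11_absolutelyContinuous : unif11 ≪ volume.restrict (Set.Icc (-1 : ℝ) 1) :=
  Measure.smul_absolutelyContinuous

lemma isFiniteMeasure_unif11 : IsFiniteMeasure unif11 := by
  refine ⟨?_⟩
  rw [unif11, Measure.smul_apply, smul_eq_mul]
  exact ENNReal.mul_lt_top (by simp) (measure_lt_top _ _)

lemma unif11_real_JNcell {N i : ℕ} (hi : i ∈ Finset.Icc 1 (2 * N)) :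
    unif11.real (JNcell N i) = 1 / (2 * N) := by
  obtain ⟨h1, h2⟩ := Finset.mem_Icc.mp hi
  have hN : (0 : ℝ) < N := by
    have : 0 < N := by omega
    exact_mod_cast this
  have h1' : (1 : ℝ) ≤ i := by exact_mod_cast h1
  have h2' : (i : ℝ) ≤ 2 * N := by exact_mod_cast h2
  have hsub : JNcell N i ⊆ Set.Icc (-1 : ℝ) 1 := by
    refine Set.Icc_subset_Icc ?_ ?_
    · have : 0 ≤ ((i : ℝ) - 1) / N := div_nonneg (by linarith) hN.le
      linarith
    · have : (i : ℝ) / N ≤ 2 := by rw [div_le_iff₀ hN]; exact h2'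
      linarith
  have hlen : -1 + (i : ℝ) / N - (-1 + ((i : ℝ) - 1) / N) = 1 / N := by ring
  have hvol : volume (JNcell N i) = ENNReal.ofReal (1 / N) := by
    rw [JNcell, Real.volume_Icc, hlen]
  rw [unif11, measureReal_ennreal_smul_apply, measureReal_def, Measure.restrict_eq_self _ hsub,
    hvol, ENNReal.toReal_ofReal (by positivity)]
  simp
  ring

lemma isShrinkingPartition_JNcell {m : Measure ℝ}
    (hm : m ≤ volume.restrict (Set.Icc (-1 : ℝ) 1)) :
    IsShrinkingPartition (fun N => Finset.Icc 1 (2 * N)) JNcell m unif11 where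
  measurableSet _ _ := measurableSet_Icc
  sum_restrict_left := by
    filter_upwards [eventually_gt_atTop 0] with N hN
    exact sum_restrict_JNcell hm.absolutelyContinuous hN
  sum_restrict_right := by
    filter_upwards [eventually_gt_atTop 0] with N hN
    exact sum_restrict_JNcell unif11_absolutelyContinuous hN
  null := by
    refine Eventually.of_forall fun N i _ h => hm.absolutelyContinuous ?_
    simpa [unif11] using h
  mesh ε hε := by
    filter_upwards [eventually_one_div_natCast_lt hε] with N hN i _ x hx y hy
    exact (abs_sub_le_of_mem_grid hx hy).trans_lt hN

lemma tendsto_sum_JNcell {m : Measure ℝ} (hm : m ≤ volume.restrict (Set.Icc (-1 : ℝ) 1)) :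
    Tendsto (fun N : ℕ => ((∑ i ∈ Finset.Icc 1 (2 * N), (m (JNcell N i)).toReal *
      Real.log ((2 * N : ℝ) * (m (JNcell N i)).toReal) : ℝ) : EReal)) atTop
      (𝓝 (DKL m unif11)) := by
  have : IsFiniteMeasure m := isFiniteMeasure_of_le _ hm
  have := isFiniteMeasure_unif11
  refine (isShrinkingPartition_JNcell hm).tendsto_cellDivergence.congr fun N => ?_
  congr 1
  refine Finset.sum_congr rfl fun i hi => ?_
  rw [unif11_real_JNcell hi, div_div_eq_mul_div, div_one, mul_comm (m.real _) (2 * (N : ℝ))]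
  rfl

lemma isClosed_unitSq : IsClosed unitSq := isClosed_Icc.prod isClosed_Icc

lemma sum_restrict_INcell {m : Measure (ℝ × ℝ)} (hsq : m unitSqᶜ = 0)
    (hplus : ∀ c, m {p | p.1 + p.2 = c} = 0) (hminus : ∀ c, m {p | p.2 - p.1 = c} = 0) {N : ℕ}
    (hN : 0 < N) :
    ∑ ij ∈ Finset.Icc 1 (2 * N) ×ˢ Finset.Icc 1 (2 * N), m.restrict (INcell N ij.1 ij.2) = m := by
  refine sum_restrict_eq_of_aedisjoint_of_cover (fun _ _ => measurableSet_INcell _ _ _) ?_ ?_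
  · intro a _ b _ hab
    by_cases h : a.1 = b.1
    · have h2 : a.2 ≠ b.2 := fun h2 => hab (Prod.ext h h2)
      refine measure_mono_null (t := {p | p.2 - p.1 = -1 + (a.2 : ℝ) / N}
        ∪ {p | p.2 - p.1 = -1 + (b.2 : ℝ) / N}) ?_ (measure_union_null (hminus _) (hminus _))
      exact fun p hp => grid_inter_eq_of_ne h2 hp.1.2.2 hp.2.2.2
    · refine measure_mono_null (t := {p | p.1 + p.2 = -1 + (a.1 : ℝ) / N}
        ∪ {p | p.1 + p.2 = -1 + (b.1 : ℝ) / N}) ?_ (measure_union_null (hplus _) (hplus _))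
      exact fun p hp => grid_inter_eq_of_ne h hp.1.2.1 hp.2.2.1
  · refine measure_mono_null (Set.compl_subset_compl.mpr fun p hp => ?_) hsq
    obtain ⟨i, hi, hpi⟩ := exists_grid_index hN (abs_le.mp (abs_add_le_one_of_mem_unitSq hp))
    obtain ⟨j, hj, hpj⟩ := exists_grid_index hN (abs_le.mp (abs_sub_le_one_of_mem_unitSq hp))
    exact Set.mem_iUnion₂.mpr ⟨(i, j), Finset.mem_product.mpr ⟨hi, hj⟩, hp, hpi, hpj⟩

lemma unitSq_subset_closure_interior : unitSq ⊆ closure (interior unitSq) := by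
  have hconv : Convex ℝ unitSq := (convex_Icc _ _).prod (convex_Icc _ _)
  rw [hconv.closure_interior_eq_closure_of_nonempty_interior]
  · exact subset_closure
  · refine ⟨(0, 0), ?_⟩
    rw [unitSq, interior_prod_eq, interior_Icc]
    constructor <;> constructor <;> norm_num

lemma measure_INcell_eq_zero_of_volume_eq_zero {m : Measure (ℝ × ℝ)}
    (hplus : ∀ c, m {p | p.1 + p.2 = c} = 0) (hminus : ∀ c, m {p | p.2 - p.1 = c} = 0)
    {N i j : ℕ} (hvol : volume (INcell N i j) = 0) : m (INcell N i j) = 0 := by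
  set U : Set (ℝ × ℝ) :=
    {p | (-1 + ((i : ℝ) - 1) / N < p.1 + p.2 ∧ p.1 + p.2 < -1 + (i : ℝ) / N) ∧
      (-1 + ((j : ℝ) - 1) / N < p.2 - p.1 ∧ p.2 - p.1 < -1 + (j : ℝ) / N)} with hU
  have hUo : IsOpen U :=
    (isOpen_Ioo.preimage (continuous_fst.add continuous_snd)).inter
      (isOpen_Ioo.preimage (continuous_snd.sub continuous_fst))
  have hempty : U ∩ interior unitSq = ∅ := by
    refine (hUo.inter isOpen_interior).eq_empty_of_measure_zero (μ := volume)
      (measure_mono_null ?_ hvol)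
    rintro p ⟨⟨⟨h1, h2⟩, h3, h4⟩, hp⟩
    exact ⟨interior_subset hp, ⟨h1.le, h2.le⟩, h3.le, h4.le⟩
  refine measure_mono_null (t := ({p | p.1 + p.2 = -1 + ((i : ℝ) - 1) / N}
    ∪ {p | p.1 + p.2 = -1 + (i : ℝ) / N}) ∪ ({p | p.2 - p.1 = -1 + ((j : ℝ) - 1) / N}
    ∪ {p | p.2 - p.1 = -1 + (j : ℝ) / N})) ?_
    (measure_union_null (measure_union_null (hplus _) (hplus _))
      (measure_union_null (hminus _) (hminus _)))
  rintro p ⟨hp, ⟨h1, h2⟩, h3, h4⟩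
  by_contra hcon
  simp only [Set.mem_union, Set.mem_ofPred_eq, not_or] at hcon
  have hpU : p ∈ U := ⟨⟨h1.lt_of_ne' hcon.1.1, h2.lt_of_ne hcon.1.2⟩,
    h3.lt_of_ne' hcon.2.1, h4.lt_of_ne hcon.2.2⟩
  have := mem_closure_iff.mp (unitSq_subset_closure_interior hp) U hUo hpU
  rw [hempty] at this
  exact Set.not_nonempty_empty this

lemma volume_plusDiagonal (c : ℝ) : volume {p : ℝ × ℝ | p.1 + p.2 = c} = 0 := by
  have hs : MeasurableSet {p : ℝ × ℝ | p.1 + p.2 = c} :=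
    measurableSet_eq_fun (by fun_prop) (by fun_prop)
  rw [Measure.volume_eq_prod, Measure.measure_prod_null hs]
  refine ae_of_all _ fun x => measure_mono_null (t := {c - x}) ?_ (measure_singleton _)
  intro y hy
  have : x + y = c := hy
  rw [Set.mem_singleton_iff]
  linarith

lemma volume_minusDiagonal (c : ℝ) : volume {p : ℝ × ℝ | p.2 - p.1 = c} = 0 := by
  have hs : MeasurableSet {p : ℝ × ℝ | p.2 - p.1 = c} :=
    measurableSet_eq_fun (by fun_prop) (by fun_prop)
  rw [Measure.volume_eq_prod, Measure.measure_prod_null hs]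
  refine ae_of_all _ fun x => measure_mono_null (t := {c + x}) ?_ (measure_singleton _)
  intro y hy
  have : y - x = c := hy
  rw [Set.mem_singleton_iff]
  linarith

lemma dist_le_of_mem_INcell {N i j : ℕ} {p q : ℝ × ℝ} (hp : p ∈ INcell N i j)
    (hq : q ∈ INcell N i j) : dist p q ≤ 1 / (N : ℝ) := by
  have h1 := abs_le.mp (abs_sub_le_of_mem_grid hp.2.1 hq.2.1)
  have h2 := abs_le.mp (abs_sub_le_of_mem_grid hp.2.2 hq.2.2)
  rw [Prod.dist_eq, Real.dist_eq, Real.dist_eq]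
  refine max_le (abs_le.mpr ?_) (abs_le.mpr ?_) <;> constructor <;>
    linarith [h1.1, h1.2, h2.1, h2.2]

lemma isShrinkingPartition_INcell {m : Measure (ℝ × ℝ)} (hsq : m unitSqᶜ = 0)
    (hplus : ∀ c, m {p | p.1 + p.2 = c} = 0) (hminus : ∀ c, m {p | p.2 - p.1 = c} = 0) :
    IsShrinkingPartition (fun N => Finset.Icc 1 (2 * N) ×ˢ Finset.Icc 1 (2 * N))
      (fun N ij => INcell N ij.1 ij.2) m (volume.restrict unitSq) where
  measurableSet _ _ := measurableSet_INcell _ _ _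
  sum_restrict_left := by
    filter_upwards [eventually_gt_atTop 0] with N hN
    exact sum_restrict_INcell hsq hplus hminus hN
  sum_restrict_right := by
    filter_upwards [eventually_gt_atTop 0] with N hN
    refine sum_restrict_INcell ?_ (fun c => ?_) (fun c => ?_) hN
    · simp [Measure.restrict_apply isClosed_unitSq.measurableSet.compl]
    · exact Measure.absolutelyContinuous_of_le Measure.restrict_le_self (volume_plusDiagonal c)
    · exact Measure.absolutelyContinuous_of_le Measure.restrict_le_self (volume_minusDiagonal c)
  null := by
    refine Eventually.of_forall fun N ij _ h =>
      measure_INcell_eq_zero_of_volume_eq_zero hplus hminus ?_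
    rwa [Measure.restrict_eq_self _ fun p hp => hp.1] at h
  mesh ε hε := by
    filter_upwards [eventually_one_div_natCast_lt hε] with N hN ij _ p hp q hq
    exact (dist_le_of_mem_INcell hp hq).trans_lt hN

lemma tendsto_sum_INcell {m : Measure (ℝ × ℝ)} [IsFiniteMeasure m] (hsq : m unitSqᶜ = 0)
    (hplus : ∀ c, m {p | p.1 + p.2 = c} = 0) (hminus : ∀ c, m {p | p.2 - p.1 = c} = 0) :
    Tendsto (fun N : ℕ => ((∑ i ∈ Finset.Icc 1 (2 * N), ∑ j ∈ Finset.Icc 1 (2 * N),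
      (m (INcell N i j)).toReal *
        Real.log ((m (INcell N i j)).toReal / (volume (INcell N i j)).toReal) : ℝ) : EReal))
      atTop (𝓝 (DKL m (volume.restrict unitSq))) := by
  have : IsFiniteMeasure (volume.restrict unitSq) := by
    refine isFiniteMeasure_restrict.mpr ?_
    exact (isCompact_Icc.prod isCompact_Icc).measure_lt_top.ne
  refine (isShrinkingPartition_INcell hsq hplus hminus).tendsto_cellDivergence.congr fun N => ?_
  congr 1
  rw [cellDivergence, Finset.sum_product]
  refine Finset.sum_congr rfl fun i _ => Finset.sum_congr rfl fun j _ => ?_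
  simp only [measureReal_def]
  rw [Measure.restrict_eq_self _ fun p hp => hp.1]

end Grid

section Queenons

lemma measure_le_of_mem_closure {Ω : Type*} [MeasurableSpace Ω] [TopologicalSpace Ω]
    [OpensMeasurableSpace Ω] [HasOuterApproxClosed Ω] {S : Set (ProbabilityMeasure Ω)}
    {γ : ProbabilityMeasure Ω} (hγ : γ ∈ closure S) {U : Set Ω} (hU : IsOpen U) {r : ℝ≥0∞}
    (h : ∀ μ ∈ S, μ.toMeasure U ≤ r) : γ.toMeasure U ≤ r := by
  have : (𝓝[S] γ).NeBot := mem_closure_iff_nhdsWithin_neBot.mp hγ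
  have hlim : Tendsto id (𝓝[S] γ) (𝓝 γ) := nhdsWithin_le_nhds
  refine (ProbabilityMeasure.le_liminf_measure_open_of_tendsto hlim hU).trans ?_
  refine liminf_le_of_frequently_le' (Eventually.frequently ?_)
  filter_upwards [self_mem_nhdsWithin] with μ hμ using h μ hμ

lemma measure_strip_le {μ : Measure (ℝ × ℝ)} (hsq : μ unitSqᶜ = 0) {f : ℝ × ℝ → ℝ}
    (hf : ∀ p ∈ unitSq, |f p| ≤ 1)
    (h : ∀ a b : ℝ, -1 ≤ a → a ≤ b → b ≤ 1 →
      μ {p ∈ unitSq | a ≤ f p ∧ f p ≤ b} ≤ ENNReal.ofReal (b - a)) (c : ℝ) {ε : ℝ} :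
    μ {p | c - ε < f p ∧ f p < c + ε} ≤ ENNReal.ofReal (2 * ε) := by
  have hsub : {p | c - ε < f p ∧ f p < c + ε} ∩ unitSq
      ⊆ {p ∈ unitSq | max (-1) (c - ε) ≤ f p ∧ f p ≤ min 1 (c + ε)} := fun p ⟨⟨h1, h2⟩, hp⟩ =>
    ⟨hp, max_le (abs_le.mp (hf p hp)).1 h1.le, le_min (abs_le.mp (hf p hp)).2 h2.le⟩
  rw [← measure_inter_conull (t := unitSq) hsq]
  refine (measure_mono hsub).trans ?_
  rcases le_or_gt (max (-1) (c - ε)) (min 1 (c + ε)) with hab | hab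
  · refine (h _ _ (le_max_left _ _) hab (min_le_left _ _)).trans (ENNReal.ofReal_le_ofReal ?_)
    linarith [le_max_right (-1) (c - ε), min_le_right 1 (c + ε)]
  · refine le_of_eq_of_le (measure_mono_null (t := ∅) ?_ measure_empty) zero_le
    exact fun p hp => hab.not_ge (hp.2.1.trans hp.2.2)

lemma queenon_compl_unitSq {γ : ProbabilityMeasure (ℝ × ℝ)} (hγ : γ ∈ queenons) :
    γ.toMeasure unitSqᶜ = 0 :=
  le_zero_iff.mp <| measure_le_of_mem_closure hγ isClosed_unitSq.isOpen_compl
    fun _ ⟨⟨_, _, hμ⟩, _⟩ => hμ.1.2.1.le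

lemma queenon_levelSet {γ : ProbabilityMeasure (ℝ × ℝ)} (hγ : γ ∈ queenons) {f : ℝ × ℝ → ℝ}
    (hcont : Continuous f) (hf : ∀ p ∈ unitSq, |f p| ≤ 1)
    (h : ∀ μ : Measure (ℝ × ℝ), SubUniformDiag μ → ∀ a b : ℝ, -1 ≤ a → a ≤ b → b ≤ 1 →
      μ {p ∈ unitSq | a ≤ f p ∧ f p ≤ b} ≤ ENNReal.ofReal (b - a)) (c : ℝ) :
    γ.toMeasure {p | f p = c} = 0 := by
  have hle : ∀ ε : ℝ, 0 < ε → γ.toMeasure {p | f p = c} ≤ ENNReal.ofReal (2 * ε) := by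
    intro ε hε
    refine (measure_mono (t := {p | c - ε < f p ∧ f p < c + ε}) fun p hp => ?_).trans
      (measure_le_of_mem_closure hγ ((isOpen_lt continuous_const hcont).inter
        (isOpen_lt hcont continuous_const)) fun μ ⟨⟨_, _, hμ⟩, hdiag⟩ =>
          measure_strip_le hμ.1.2.1 hf (h _ hdiag) c)
    have hp : f p = c := hp
    constructor <;> linarith
  have hlim : Tendsto (fun ε : ℝ => ENNReal.ofReal (2 * ε)) (𝓝[>] 0) (𝓝 0) := by
    have : Continuous fun ε : ℝ => ENNReal.ofReal (2 * ε) :=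
      ENNReal.continuous_ofReal.comp (continuous_const_mul 2)
    simpa using (this.tendsto 0).mono_left nhdsWithin_le_nhds
  exact le_zero_iff.mp (ge_of_tendsto hlim (eventually_nhdsWithin_of_forall hle))

end Queenons

/-- **Lemma (step approximation of the entropy).**
For every queenon `γ`, `H_q^N(γ) → H_q(γ)` as `N → ∞`, in the extended reals. -/
theorem HqN_tendsto_Hq (γ : ProbabilityMeasure (ℝ × ℝ)) (hγ : γ ∈ queenons) :
    Tendsto (fun N : ℕ => ((HqN N γ.toMeasure : ℝ) : EReal)) atTop
      (𝓝 (Hq γ.toMeasure)) := by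
  have hA := tendsto_sum_INcell (queenon_compl_unitSq hγ)
    (queenon_levelSet hγ (by fun_prop) (fun _ => abs_add_le_one_of_mem_unitSq)
      fun _ h a b h1 h2 h3 => (h a b h1 h2 h3).1)
    (queenon_levelSet hγ (by fun_prop) (fun _ => abs_sub_le_one_of_mem_unitSq)
      fun _ h a b h1 h2 h3 => (h a b h1 h2 h3).2)
  have hB := tendsto_sum_JNcell (m := barPlus γ.toMeasure) Measure.sub_le
  have hC := tendsto_sum_JNcell (m := barMinus γ.toMeasure) Measure.sub_le
  have hneg {x : EReal} (hx : x ≠ ⊥) : -x ≠ ⊤ := by simpa [EReal.neg_eq_top_iff] using hx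
  have hadd {a b : ℕ → EReal} {x y : EReal} (ha : Tendsto a atTop (𝓝 x))
      (hb : Tendsto b atTop (𝓝 y)) (hx : x ≠ ⊤) (hy : y ≠ ⊤) :
      Tendsto (fun N => a N + b N) atTop (𝓝 (x + y)) :=
    (EReal.continuousAt_add (p := (x, y)) (Or.inl hx) (Or.inr hy)).tendsto.comp
      (ha.prodMk_nhds hb)
  have hA' := (continuous_neg.tendsto _).comp hA
  have hB' := (continuous_neg.tendsto _).comp hB
  have hC' := (continuous_neg.tendsto _).comp hC
  have hxA := hneg (DKL_ne_bot γ.toMeasure (volume.restrict unitSq))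
  have hxB := hneg (DKL_ne_bot (barPlus γ.toMeasure) unif11)
  have hxC := hneg (DKL_ne_bot (barMinus γ.toMeasure) unif11)
  have hAB := hadd hA' hB' hxA hxB
  have hABC := hadd hAB hC' (EReal.add_ne_top hxA hxB) hxC
  have hall := hadd hABC (tendsto_const_nhds (x := ((2 * Real.log 2 - 3 : ℝ) : EReal)))
    (EReal.add_ne_top (EReal.add_ne_top hxA hxB) hxC) (EReal.coe_ne_top _)
  simp only [Hq, sub_eq_add_neg (G := EReal)]
  refine hall.congr fun N => ?_
  simp only [Function.comp_apply, HqN]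
  rw [← EReal.coe_neg, ← EReal.coe_neg, ← EReal.coe_neg, ← EReal.coe_add, ← EReal.coe_add,
    ← EReal.coe_add]
  congr 1
  ring

end
end
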